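/- arXiv:1911.00309 — 2 statements merged into one kernel-verified Lean document; each statement's English description precedes it below -/
import Mathlib

section
/- Let (K, O_v) be a valued field such that O_v is a henselian local ring, the residue field of O_v has characteristic p > 0, and K admits no finite separable field extension of degree divisible by p. Then (K, O_v) is separably defectless. -/
variable {K : Type*} [Field K] {L : Type*} [Field L]

/-- The ring homomorphism between valuation subrings induced by a field embedding,
when the lower valuation subring is the pullback of the upper one. -/
def prolongHom (f : K →+* L) (Ov : ValuationSubring K) (Ow : ValuationSubring L)
    (h : Ow.comap f = Ov) : Ov →+* Ow where
  toFun x := ⟨f x, by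
    have hx : (x : K) ∈ Ow.comap f := by rw [h]; exact x.2
    exact ValuationSubring.mem_comap.mp hx⟩
  map_one' := by ext; simp
  map_mul' x y := by ext; simp
  map_zero' := by ext; simp
  map_add' x y := by ext; simp

theorem prolongHom_isLocalHom (f : K →+* L) (Ov : ValuationSubring K)
    (Ow : ValuationSubring L) (h : Ow.comap f = Ov) :
    IsLocalHom (prolongHom f Ov Ow h) := by
  constructor
  intro a ha
  rcases isUnit_iff_exists_inv.mp ha with ⟨b, hb⟩
  have hb' : f a * (b : L) = 1 := congrArg Subtype.val hb
  have hfa : f (a : K) ≠ 0 := left_ne_zero_of_mul_eq_one hb'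
  have ha0 : (a : K) ≠ 0 := by
    intro h0
    exact hfa (by rw [h0, map_zero])
  have hbeq : (b : L) = f ((a : K)⁻¹) := by
    rw [map_inv₀]
    exact eq_inv_of_mul_eq_one_right hb'
  have hmem : (a : K)⁻¹ ∈ Ov := by
    have hm : (a : K)⁻¹ ∈ Ow.comap f := ValuationSubring.mem_comap.mpr (hbeq ▸ b.2)
    rwa [h] at hm
  refine isUnit_iff_exists_inv.mpr ⟨⟨(a : K)⁻¹, hmem⟩, ?_⟩
  ext
  simp [mul_inv_cancel₀ ha0]

/-- The induced embedding of residue fields. -/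
noncomputable def residueFieldMap (f : K →+* L) (Ov : ValuationSubring K)
    (Ow : ValuationSubring L) (h : Ow.comap f = Ov) :
    IsLocalRing.ResidueField Ov →+* IsLocalRing.ResidueField Ow :=
  haveI := prolongHom_isLocalHom f Ov Ow h
  IsLocalRing.ResidueField.map (prolongHom f Ov Ow h)

/-- The ramification index `e(w/v)`: the index of the image of `Kˣ/Ovˣ` in `Lˣ/Owˣ`. -/
noncomputable def ramificationIndex (f : K →+* L) (Ow : ValuationSubring L) : ℕ :=
  ((QuotientGroup.mk' Ow.unitGroup).comp (Units.map (f : K →* L))).range.index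

open scoped Classical in
/-- The inertia degree `f(w/v)`: the degree of the residue field extension. -/
noncomputable def inertiaDegree (f : K →+* L) (Ov : ValuationSubring K)
    (Ow : ValuationSubring L) : ℕ :=
  if h : Ow.comap f = Ov then
    @Module.finrank (IsLocalRing.ResidueField Ov) (IsLocalRing.ResidueField Ow) _ _
      (residueFieldMap f Ov Ow h).toModule
  else 0

/-- The set of prolongations of a valuation subring of `K` to `L`. -/
def prolongations (Ov : ValuationSubring K) (L : Type*) [Field L] [Algebra K L] :
    Set (ValuationSubring L) :=
  {Ow | Ow.comap (algebraMap K L) = Ov}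

/-- The fundamental equality for the extension `L/K`. -/
def FundamentalEquality (Ov : ValuationSubring K) (L : Type*) [Field L] [Algebra K L] : Prop :=
  (prolongations Ov L).Finite ∧
    Module.finrank K L =
      ∑ᶠ Ow ∈ prolongations Ov L,
        ramificationIndex (algebraMap K L) Ow * inertiaDegree (algebraMap K L) Ov Ow

/-- A valued field is defectless if the fundamental equality holds for every
finite extension. -/
def IsDefectless {K : Type u} [Field K] (Ov : ValuationSubring K) : Prop :=
  ∀ (L : Type u) [Field L] [Algebra K L], FiniteDimensional K L →
    FundamentalEquality Ov L

/-- A valued field is separably defectless if the fundamental equality holds for every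
finite separable extension. -/
def IsSeparablyDefectless {K : Type u} [Field K] (Ov : ValuationSubring K) : Prop :=
  ∀ (L : Type u) [Field L] [Algebra K L], FiniteDimensional K L →
    Algebra.IsSeparable K L → FundamentalEquality Ov L

open Polynomial IsLocalRing in
open scoped Pointwise in
theorem isLocalRing_of_henselian_of_isInvariant (A B G : Type*) [CommRing A]
    [HenselianLocalRing A] [CommRing B] [IsDomain B] [Algebra A B] [Group G] [Finite G]
    [MulSemiringAction G B] [SMulCommClass G A B] [Algebra.IsInvariant A B G] :
    IsLocalRing B := by
  classical
  have := Fintype.ofFinite G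
  have hint : Algebra.IsIntegral A B := Algebra.IsInvariant.isIntegral A B G
  have under_eq (P : Ideal B) [P.IsMaximal] : P.under A = maximalIdeal A :=
    IsLocalRing.eq_maximalIdeal (Ideal.isMaximal_comap_of_isIntegral_of_isMaximal P)
  obtain ⟨P, hP⟩ := Ideal.exists_maximal B
  suffices stab : ∀ g : G, g • P = P by
    refine IsLocalRing.of_unique_max_ideal ⟨P, hP, fun Q hQ => ?_⟩
    obtain ⟨g, hg⟩ := Algebra.IsInvariant.exists_smul_of_under_eq A B G P Q
      ((under_eq P).trans (under_eq Q).symm)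
    rw [hg, stab]
  have maxl (g : G) : (g • P).IsMaximal := by
    rw [show g • P = P.comap (MulSemiringAction.toRingEquiv G B g⁻¹) from
      Ideal.ext fun x => Ideal.mem_pointwise_smul_iff_inv_smul_mem]
    exact Ideal.comap_isMaximal_of_equiv _
  obtain ⟨a', ha'I, ha'P⟩ : ∃ a' : B, (∀ g : G, g • P ≠ P → a' ∈ g • P) ∧ a' - 1 ∈ P := by
    have hsup : P ⊔ (⨅ g : G, ⨅ _ : g ∈ {g : G | g • P ≠ P}, g • P) = ⊤ := by
      have := Ideal.sup_iInf_eq_top (I := P) (s := (Finset.univ.filter fun g : G => g • P ≠ P))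
        (J := fun g => g • P) (fun g hg => by
          have := (Finset.mem_filter.mp hg).2
          exact Ideal.IsMaximal.coprime_of_ne hP (maxl g) (Ne.symm this))
      simpa using this
    obtain ⟨x, hx, y, hy, hxy⟩ := Submodule.mem_sup.mp
      ((Ideal.eq_top_iff_one _).mp hsup)
    refine ⟨y, fun g hg => ?_, ?_⟩
    · simp only [Submodule.mem_iInf] at hy
      exact hy g hg
    · rw [← hxy, sub_add_cancel_right]
      exact P.neg_mem hx
  let D : Subgroup G := MulAction.stabilizer G P
  let a : B := ∏ d : D, (d : G) • a'
  have ha_fix (g : G) (hg : g • P = P) : g • a = a := by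
    simp only [a, Finset.smul_prod', smul_smul]
    exact Fintype.prod_equiv (Equiv.mulLeft (⟨g, hg⟩ : D)) _ _ fun d => rfl
  have ha_one : Ideal.Quotient.mk P a = 1 := by
    simp only [a, map_prod]
    refine Finset.prod_eq_one fun d _ => ?_
    rw [← map_one (Ideal.Quotient.mk P), Ideal.Quotient.eq]
    have h := Ideal.smul_mem_pointwise_smul (d : G) _ _ ha'P
    rwa [show (d : G) • P = P from d.2, smul_sub, smul_one] at h
  have ha_mem (g : G) (hg : g • P ≠ P) : Ideal.Quotient.mk P (g • a) = 0 := by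
    rw [Ideal.Quotient.eq_zero_iff_mem]
    have h1 : a ∈ g⁻¹ • P := by
      refine Ideal.mem_of_dvd _ (Finset.dvd_prod_of_mem _ (Finset.mem_univ (1 : D))) ?_
      simp only [Subgroup.coe_one, one_smul]
      exact ha'I _ fun h => hg (by rw [smul_eq_iff_eq_inv_smul, h])
    simpa using Ideal.smul_mem_pointwise_smul g _ _ h1
  -- the orbit polynomial of `a`, which reduces to a product of `X - 1` and a power of `X`
  let f := prodXSubSMul G B a
  obtain ⟨F, hF, hFm⟩ : ∃ F : A[X], F.map (algebraMap A B) = f ∧ F.Monic := by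
    have hl : f ∈ Polynomial.lifts (algebraMap A B) :=
      (Polynomial.lifts_iff_coeff_lifts _).mpr fun n =>
        Algebra.IsInvariant.isInvariant (A := A) (G := G) _
          fun g => prodXSubSMul.coeff G B a g n
    obtain ⟨F, h1, -, h2⟩ := lifts_and_natDegree_eq_and_monic hl (prodXSubSMul.monic G B a)
    exact ⟨F, h1, h2⟩
  let r : (G ⧸ MulAction.stabilizer G a) → B := MulAction.ofQuotientStabilizer G a
  let R : B[X] := ∏ q ∈ Finset.univ.erase ((1 : G) : G ⧸ MulAction.stabilizer G a), (X - C (r q))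
  have hfR : f = (X - C a) * R := by
    have h := Finset.mul_prod_erase Finset.univ (fun q => X - C (r q))
      (Finset.mem_univ ((1 : G) : G ⧸ MulAction.stabilizer G a))
    simp only [r, MulAction.ofQuotientStabilizer_mk, one_smul] at h
    exact h.symm
  have hR : Ideal.Quotient.mk P (R.eval 1) = 1 := by
    simp only [R, eval_prod, map_prod]
    refine Finset.prod_eq_one fun q hq => ?_
    induction q using QuotientGroup.induction_on with
    | H g =>
      have hg : g • P ≠ P := fun h => (Finset.mem_erase.mp hq).1 <| by
        rw [eq_comm, QuotientGroup.eq]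
        simpa using ha_fix g h
      simp [r, ha_mem g hg]
  have mem_iff (c : A) : c ∈ maximalIdeal A ↔ Ideal.Quotient.mk P (algebraMap A B c) = 0 := by
    rw [Ideal.Quotient.eq_zero_iff_mem, ← under_eq P]; rfl
  obtain ⟨c, hc, hc1⟩ := HenselianLocalRing.is_henselian F hFm 1
    (by
      rw [mem_iff, ← eval₂_at_apply, ← eval_map, hF, hfR]
      simp [ha_one])
    (by
      rw [← not_not (a := IsUnit _), ← mem_nonunits_iff, ← mem_maximalIdeal, mem_iff,
        ← eval₂_at_apply, ← eval_map, ← derivative_map, hF, hfR]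
      simp [ha_one, hR])
  have hc0 : f.eval (algebraMap A B c) = 0 := by
    rw [← hF, eval_map, eval₂_at_apply, hc.eq_zero, map_zero]
  obtain ⟨q, -, hq⟩ := Finset.prod_eq_zero_iff.mp ((eval_prod _ _ _).symm.trans hc0)
  have hac : a = algebraMap A B c := by
    induction q using QuotientGroup.induction_on with
    | H g =>
      rw [eval_sub, eval_X, eval_C, MulAction.ofQuotientStabilizer_mk, sub_eq_zero] at hq
      rw [← smul_algebraMap g⁻¹ c, hq, inv_smul_smul]
  intro g
  by_contra hg
  have h := ha_mem g hg
  rw [hac, smul_algebraMap, ← hac, ha_one] at h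
  exact one_ne_zero h

theorem exists_valuationSubring_toSubring_eq {K N : Type*} [Field K] [Field N] [Algebra K N]
    [Algebra.IsAlgebraic K N] (Ov : ValuationSubring K)
    (hloc : IsLocalRing (integralClosure Ov N)) :
    ∃ W : ValuationSubring N, W.toSubring = (integralClosure Ov N).toSubring := by
  let B : Subring N := (integralClosure Ov N).toSubring
  have mem_B {y : N} (hy : ∀ V : ValuationSubring N, B ≤ V.toSubring → y ∈ V) : y ∈ B := by
    have : IsIntegrallyClosedIn B N :=
      inferInstanceAs (IsIntegrallyClosedIn (integralClosure Ov N) N)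
    by_contra h
    obtain ⟨V, hV, hyV⟩ := Subring.exists_le_valuationSubring_of_isIntegrallyClosedIn h
    exact hyV (hy V hV)
  have map_mem {c : K} (hc : c ∈ Ov) : algebraMap K N c ∈ B :=
    (integralClosure Ov N).algebraMap_mem ⟨c, hc⟩
  let R : LocalSubring N := { toSubring := B, isLocalRing := hloc }
  obtain ⟨V, hV⟩ := LocalSubring.exists_le_valuationSubring R
  obtain ⟨hRV, hRVloc⟩ := hV
  refine ⟨V, le_antisymm (fun x (hx : x ∈ V) => ?_) hRV⟩
  change x ∈ B
  have unit_of {y : N} (hy : y ∈ B) (hy1 : V.valuation y = 1) : y⁻¹ ∈ B := by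
    have h1 : IsUnit (⟨y, hRV hy⟩ : V) := (V.valuation_eq_one_iff _).mpr hy1
    have h2 : IsUnit (⟨y, hy⟩ : B) := by
      have := hRVloc
      exact isUnit_of_map_unit (Subring.inclusion hRV) ⟨y, hy⟩ h1
    obtain ⟨⟨z, hz⟩, h⟩ := isUnit_iff_exists_inv.mp h2
    have hyz : y * z = 1 := congrArg Subtype.val h
    rwa [inv_eq_of_mul_eq_one_right hyz]
  have lt_one {c : K} (hc : Ov.valuation c < 1) : V.valuation (algebraMap K N c) < 1 := by
    by_contra h
    have hcO : c ∈ Ov := (Ov.valuation_le_one_iff c).mp hc.le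
    have h1 : V.valuation (algebraMap K N c) = 1 :=
      le_antisymm ((V.valuation_le_one_iff _).mpr (hRV (map_mem hcO))) (not_lt.mp h)
    have h2 := unit_of (map_mem hcO) h1
    rw [← map_inv₀] at h2
    have h3 : IsIntegral Ov (algebraMap K N c⁻¹) := h2
    rw [isIntegral_algebraMap_iff (algebraMap K N).injective] at h3
    obtain ⟨d, hd⟩ := IsIntegrallyClosed.isIntegral_iff.mp h3
    have hd' : c⁻¹ ∈ Ov := hd ▸ d.2
    rw [← Ov.valuation_le_one_iff, map_inv₀] at hd'
    have hc0 : c ≠ 0 := by rintro rfl; simp at h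
    exact absurd ((inv_le_one₀ (by simpa [zero_lt_iff] using hc0)).mp hd') (not_le.mpr hc)
  -- choose the last coefficient of maximal value of an equation of `x`
  obtain ⟨p, hp0, hpx⟩ := Algebra.IsAlgebraic.isAlgebraic (R := K) x
  obtain ⟨s, hs, hmax⟩ := Finset.exists_max_image (Finset.range (p.natDegree + 1))
    (fun i => toLex (Ov.valuation (p.coeff i), i)) ⟨0, by simp⟩
  have hcs : p.coeff s ≠ 0 := by
    intro h
    have := hmax p.natDegree (by simp)
    rw [Prod.Lex.toLex_le_toLex] at this
    simp [h, hp0] at this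
  have hle {i : ℕ} (hi : i ≤ p.natDegree) : Ov.valuation (p.coeff i / p.coeff s) ≤ 1 := by
    have := hmax i (by simpa [Nat.lt_succ_iff] using hi)
    rw [map_div₀, div_le_one₀ (by simpa [zero_lt_iff] using hcs)]
    rw [Prod.Lex.toLex_le_toLex] at this
    rcases this with h | h
    exacts [h.le, h.1.le]
  have hlt {i : ℕ} (hi : i ≤ p.natDegree) (hsi : s < i) :
      Ov.valuation (p.coeff i / p.coeff s) < 1 := by
    have := hmax i (by simpa [Nat.lt_succ_iff] using hi)
    rw [map_div₀, div_lt_one₀ (by simpa [zero_lt_iff] using hcs)]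
    rw [Prod.Lex.toLex_le_toLex] at this
    rcases this with h | h
    exacts [h, absurd h.2 (not_le.mpr hsi)]
  by_cases hx0 : x = 0
  · rw [hx0]; exact B.zero_mem
  obtain ⟨m, hm⟩ : ∃ m, p.natDegree + 1 = s + (m + 1) :=
    ⟨p.natDegree - s, by have := Finset.mem_range.mp hs; omega⟩
  let b : ℕ → N := fun i => algebraMap K N (p.coeff i / p.coeff s)
  have hb {i : ℕ} (hi : i ≤ p.natDegree) : b i ∈ B :=
    map_mem ((Ov.valuation_le_one_iff _).mp (hle hi))
  let y : N := ∑ j ∈ Finset.range (m + 1), b (s + j) * x ^ j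
  let z : N := ∑ i ∈ Finset.range s, b i * x⁻¹ ^ (s - 1 - i)
  have hyz : y * x = -z := by
    have h0 : ∑ i ∈ Finset.range (p.natDegree + 1), b i * x ^ i = 0 := by
      have h : (∑ i ∈ Finset.range (p.natDegree + 1), algebraMap K N (p.coeff i) * x ^ i) = 0 := by
        rw [← hpx, Polynomial.aeval_eq_sum_range]
        simp [Algebra.smul_def]
      rw [← mul_zero (algebraMap K N (p.coeff s))⁻¹, ← h, Finset.mul_sum]
      refine Finset.sum_congr rfl fun i _ => ?_
      simp only [b, map_div₀]
      ring
    rw [hm, Finset.sum_range_add] at h0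
    have h1 : ∑ j ∈ Finset.range (m + 1), b (s + j) * x ^ (s + j) = y * x ^ s := by
      simp only [y, Finset.sum_mul, pow_add]
      exact Finset.sum_congr rfl fun i _ => by ring
    have h2 : (∑ i ∈ Finset.range s, b i * x ^ i) * x = z * x ^ s := by
      simp only [z, Finset.sum_mul]
      refine Finset.sum_congr rfl fun i hi => ?_
      have hi := Finset.mem_range.mp hi
      obtain ⟨k, rfl⟩ : ∃ k, s = k + 1 + i := ⟨s - 1 - i, by omega⟩
      rw [show k + 1 + i - 1 - i = k by omega, inv_pow]
      field_simp
      ring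
    rw [h1] at h0
    have h3 : (y * x + z) * x ^ s = 0 := by
      linear_combination x * h0 - h2
    exact eq_neg_of_add_eq_zero_left ((mul_eq_zero.mp h3).resolve_right (pow_ne_zero _ hx0))
  have key (V' : ValuationSubring N) (hV' : B ≤ V'.toSubring) : y ∈ V' ∧ y * x ∈ V' := by
    rcases V'.mem_or_inv_mem x with h | h
    · have hy : y ∈ V' := sum_mem fun j hj => V'.mul_mem _ _
        (hV' (hb (by have := Finset.mem_range.mp hj; omega))) (pow_mem h _)
      exact ⟨hy, V'.mul_mem _ _ hy h⟩
    · have hz : y * x ∈ V' := hyz ▸ V'.neg_mem _ (sum_mem fun i hi => V'.mul_mem _ _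
        (hV' (hb (by have := Finset.mem_range.mp hi; omega))) (pow_mem h _))
      refine ⟨?_, hz⟩
      simpa [mul_assoc, hx0] using V'.mul_mem _ _ hz h
  have hyB : y ∈ B := mem_B fun V' hV' => (key V' hV').1
  have hyxB : y * x ∈ B := mem_B fun V' hV' => (key V' hV').2
  have hy1 : V.valuation y = 1 := by
    have h : y = (∑ j ∈ Finset.range m, b (s + (j + 1)) * x ^ (j + 1)) + 1 := by
      simp only [y, Finset.sum_range_succ']
      simp [b, hcs]
    rw [h]
    refine V.valuation.map_one_add_of_lt ?_ |> fun h => by rwa [add_comm] at h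
    refine Valuation.map_sum_lt _ one_ne_zero fun j hj => ?_
    rw [map_mul]
    refine mul_lt_one_of_lt_of_le (lt_one (hlt ?_ (by omega))) ?_
    · have := Finset.mem_range.mp hj; omega
    · exact (V.valuation_le_one_iff _).mpr (pow_mem hx _)
  have := B.mul_mem hyxB (unit_of hyB hy1)
  have hy0 : y ≠ 0 := by rintro h; simp [h] at hy1
  rwa [mul_assoc, mul_comm x, mul_inv_cancel_left₀ hy0] at this

theorem ValuationSubring.valuation_le_iff_of_comap_eq {f : K →+* L} {Ov : ValuationSubring K}
    {Ow : ValuationSubring L} (h : Ow.comap f = Ov) (a b : K) :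
    Ov.valuation a ≤ Ov.valuation b ↔ Ow.valuation (f a) ≤ Ow.valuation (f b) := by
  rcases eq_or_ne b 0 with rfl | hb
  · simp
  have hb' : f b ≠ 0 := (map_ne_zero f).mpr hb
  rw [← div_le_one₀ (a := Ov.valuation a) (by simpa [zero_lt_iff] using hb),
    ← div_le_one₀ (a := Ow.valuation (f a)) (by simpa [zero_lt_iff] using hb'), ← map_div₀,
    ← map_div₀, ← map_div₀,
    Ov.valuation_le_one_iff, Ow.valuation_le_one_iff, ← h, ValuationSubring.mem_comap]

theorem ValuationSubring.valuation_lt_one_iff_of_comap_eq {f : K →+* L} {Ov : ValuationSubring K}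
    {Ow : ValuationSubring L} (h : Ow.comap f = Ov) (a : K) :
    Ov.valuation a < 1 ↔ Ow.valuation (f a) < 1 := by
  simpa using (valuation_le_iff_of_comap_eq h 1 a).not

theorem ValuationSubring.valuation_eq_iff_of_comap_eq {f : K →+* L} {Ov : ValuationSubring K}
    {Ow : ValuationSubring L} (h : Ow.comap f = Ov) (a b : K) :
    Ov.valuation a = Ov.valuation b ↔ Ow.valuation (f a) = Ow.valuation (f b) := by
  rw [le_antisymm_iff, le_antisymm_iff, valuation_le_iff_of_comap_eq h,
    valuation_le_iff_of_comap_eq h]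

/-- A valuation subring of an extension field, all of whose elements are integral over the
valuation subring below, is the only prolongation containing it. -/
theorem ValuationSubring.eq_of_le_of_isIntegral {f : K →+* L} {Ov : ValuationSubring K}
    {A C : ValuationSubring L} (hA : A.comap f = Ov) (hC : C.comap f = Ov) (hle : A ≤ C)
    (hint : (prolongHom f Ov A hA).IsIntegral) : A = C := by
  have hmax : (A.idealOfLE C hle).IsMaximal := by
    refine Ideal.isMaximal_of_isIntegral_of_isMaximal_comap' _ hint _ ?_
    convert IsLocalRing.maximalIdeal.isMaximal Ov
    ext c
    rw [Ideal.mem_comap, ValuationSubring.idealOfLE, Ideal.mem_comap,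
      ValuationSubring.valuation_lt_one_iff, ValuationSubring.valuation_lt_one_iff,
      valuation_lt_one_iff_of_comap_eq hC]
    rfl
  have h := A.ofPrime_idealOfLE C hle
  simp only [IsLocalRing.eq_maximalIdeal hmax, ofPrime_top] at h
  exact h

theorem mem_range_unitsMap_sup_unitGroup {f : K →+* L} {Ow : ValuationSubring L} {x : Lˣ} :
    x ∈ (Units.map (f : K →* L)).range ⊔ Ow.unitGroup ↔
      ∃ k : Kˣ, Ow.valuation x = Ow.valuation (f k) := by
  rw [Subgroup.mem_sup]
  constructor
  · rintro ⟨_, ⟨k, rfl⟩, u, hu, rfl⟩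
    rw [ValuationSubring.mem_unitGroup_iff] at hu
    exact ⟨k, by simp [hu]⟩
  · rintro ⟨k, hk⟩
    refine ⟨_, ⟨k, rfl⟩, (Units.map (f : K →* L) k)⁻¹ * x, ?_, mul_inv_cancel_left _ _⟩
    rw [ValuationSubring.mem_unitGroup_iff]
    simp [hk]

theorem ramificationIndex_eq_index (f : K →+* L) (Ow : ValuationSubring L) :
    ramificationIndex f Ow = ((Units.map (f : K →* L)).range ⊔ Ow.unitGroup).index := by
  have h := Subgroup.comap_map_eq (QuotientGroup.mk' Ow.unitGroup) (Units.map (f : K →* L)).range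
  rw [QuotientGroup.ker_mk', ← MonoidHom.range_comp] at h
  rw [← h, Subgroup.index_comap_of_surjective _ (QuotientGroup.mk'_surjective _)]
  rfl

theorem inertiaDegree_eq_finrank {f : K →+* L} {Ov : ValuationSubring K}
    {Ow : ValuationSubring L} (h : Ow.comap f = Ov) :
    inertiaDegree f Ov Ow = @Module.finrank (IsLocalRing.ResidueField Ov)
      (IsLocalRing.ResidueField Ow) _ _ (residueFieldMap f Ov Ow h).toModule :=
  dif_pos h

@[simp]
theorem residueFieldMap_residue {f : K →+* L} {Ov : ValuationSubring K}
    {Ow : ValuationSubring L} (h : Ow.comap f = Ov) (c : Ov) :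
    residueFieldMap f Ov Ow h (IsLocalRing.residue Ov c) =
      IsLocalRing.residue Ow (prolongHom f Ov Ow h c) :=
  rfl

theorem ramificationIndex_comp {M : Type*} [Field M] (f : K →+* M) (g : M →+* L)
    (Ow : ValuationSubring L) :
    ramificationIndex (g.comp f) Ow =
      ramificationIndex f (Ow.comap g) * ramificationIndex g Ow := by
  simp only [ramificationIndex_eq_index]
  have hle : (Units.map (g.comp f : K →* L)).range ⊔ Ow.unitGroup ≤
      (Units.map (g : M →* L)).range ⊔ Ow.unitGroup := by
    refine sup_le_sup_right ?_ _
    rintro _ ⟨k, rfl⟩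
    exact ⟨Units.map (f : K →* M) k, rfl⟩
  have hsup : (Units.map (g : M →* L)).range ⊔ Ow.unitGroup =
      (Units.map (g : M →* L)).range ⊔ ((Units.map (g.comp f : K →* L)).range ⊔ Ow.unitGroup) :=
    le_antisymm (sup_le_sup_left le_sup_right _) (sup_le le_sup_left hle)
  rw [← Subgroup.relIndex_mul_index hle]
  congr 1
  rw [hsup, Subgroup.relIndex_sup_right, ← Subgroup.index_comap]
  congr 1
  ext m
  rw [Subgroup.mem_comap]
  erw [mem_range_unitsMap_sup_unitGroup, mem_range_unitsMap_sup_unitGroup]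
  exact exists_congr fun k => (ValuationSubring.valuation_eq_iff_of_comap_eq rfl _ _).symm

theorem inertiaDegree_comp {M : Type*} [Field M] {f : K →+* M} {g : M →+* L}
    {Ov : ValuationSubring K} {Om : ValuationSubring M} {Ow : ValuationSubring L}
    (hf : Om.comap f = Ov) (hg : Ow.comap g = Om) :
    inertiaDegree (g.comp f) Ov Ow = inertiaDegree f Ov Om * inertiaDegree g Om Ow := by
  have hgf : Ow.comap (g.comp f) = Ov := by
    rw [← hf, ← hg]; rfl
  rw [inertiaDegree_eq_finrank hf, inertiaDegree_eq_finrank hg, inertiaDegree_eq_finrank hgf]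
  let := (residueFieldMap f Ov Om hf).toAlgebra
  let := (residueFieldMap g Om Ow hg).toAlgebra
  let := (residueFieldMap (g.comp f) Ov Ow hgf).toAlgebra
  have : IsScalarTower (IsLocalRing.ResidueField Ov) (IsLocalRing.ResidueField Om)
      (IsLocalRing.ResidueField Ow) := by
    refine IsScalarTower.of_algebraMap_eq fun x => ?_
    obtain ⟨c, rfl⟩ := IsLocalRing.residue_surjective x
    rfl
  exact (Module.finrank_mul_finrank _ _ _).symm

/-- A combination of elements with linearly independent residues has the value of its largest
coefficient. -/
theorem exists_valuation_sum_eq {I : Type*} {f : K →+* L} {Ov : ValuationSubring K}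
    {Ow : ValuationSubring L} (h : Ow.comap f = Ov) (x : I → Ow)
    (hx : letI := (residueFieldMap f Ov Ow h).toAlgebra
      LinearIndependent (IsLocalRing.ResidueField Ov) fun i => IsLocalRing.residue Ow (x i))
    (s : Finset I) (c : I → K) (hc : ∃ i ∈ s, c i ≠ 0) :
    ∃ k : K, k ≠ 0 ∧ Ow.valuation (∑ i ∈ s, f (c i) * x i) = Ow.valuation (f k) := by
  let := (residueFieldMap f Ov Ow h).toAlgebra
  obtain ⟨i₁, hi₁, hci₁⟩ := hc
  obtain ⟨i₀, hi₀, hmax⟩ := Finset.exists_max_image s (fun i => Ov.valuation (c i)) ⟨i₁, hi₁⟩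
  have hc₀ : c i₀ ≠ 0 := by
    intro h0
    simpa [h0, hci₁] using hmax i₁ hi₁
  refine ⟨c i₀, hc₀, ?_⟩
  have hd (i : s) : c i / c i₀ ∈ Ov := by
    rw [← Ov.valuation_le_one_iff, map_div₀, div_le_one₀ (by simpa [zero_lt_iff] using hc₀)]
    exact hmax i i.2
  let d : s → Ov := fun i => ⟨_, hd i⟩
  let u : Ow := ∑ i : s, prolongHom f Ov Ow h (d i) * x i
  have hu : IsUnit u := by
    rw [← IsLocalRing.residue_ne_zero_iff_isUnit]
    intro h0
    have h1 : ∑ i : s, IsLocalRing.residue Ov (d i) • IsLocalRing.residue Ow (x i) = 0 := by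
      rw [← h0, map_sum]
      refine Finset.sum_congr rfl fun i _ => ?_
      rw [Algebra.smul_def, map_mul]
      rfl
    have h2 := Fintype.linearIndependent_iff.mp (hx.comp _ Subtype.val_injective) _ h1 ⟨i₀, hi₀⟩
    have h3 : d ⟨i₀, hi₀⟩ = 1 := Subtype.ext (div_self hc₀)
    rw [h3, map_one] at h2
    exact one_ne_zero h2
  have hsum : ∑ i ∈ s, f (c i) * x i = f (c i₀) * u := by
    rw [← Finset.sum_coe_sort, AddSubmonoidClass.coe_finsetSum, Finset.mul_sum]
    refine Finset.sum_congr rfl fun i _ => ?_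
    simp only [MulMemClass.coe_mul, prolongHom, RingHom.coe_mk, MonoidHom.coe_mk, OneHom.coe_mk, d,
      map_div₀]
    have := (map_ne_zero f).mpr hc₀
    field_simp
  rw [hsum, map_mul, (Ow.valuation_eq_one_iff u).mp hu, mul_one]

theorem linearIndependent_mul {I J : Type*} [Algebra K L] {Ov : ValuationSubring K}
    {Ow : ValuationSubring L} (h : Ow.comap (algebraMap K L) = Ov) (x : I → Ow)
    (hx : letI := (residueFieldMap (algebraMap K L) Ov Ow h).toAlgebra
      LinearIndependent (IsLocalRing.ResidueField Ov) fun i => IsLocalRing.residue Ow (x i))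
    (y : J → L) (hy0 : ∀ j, y j ≠ 0)
    (hy : ∀ j j' (k : K), k ≠ 0 →
      Ow.valuation (y j) = Ow.valuation (algebraMap K L k * y j') → j = j') :
    LinearIndependent K fun ij : I × J => (x ij.1 : L) * y ij.2 := by
  classical
  rw [linearIndependent_iff'']
  intro s c hcs hsum
  by_contra! hne
  obtain ⟨⟨i₁, j₁⟩, hc₁⟩ := hne
  let S := s.image Prod.fst
  let T := (s.image Prod.snd).filter fun j => ∃ i ∈ S, c (i, j) ≠ 0
  let z : J → L := fun j => ∑ i ∈ S, algebraMap K L (c (i, j)) * x i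
  have hz (j : J) (hj : j ∈ T) :
      ∃ k : K, k ≠ 0 ∧ Ow.valuation (z j) = Ow.valuation (algebraMap K L k) :=
    exists_valuation_sum_eq h x hx S (fun i => c (i, j)) (Finset.mem_filter.mp hj).2
  have hzT : ∑ j ∈ T, z j * y j = 0 := by
    have h1 : ∑ j ∈ T, z j * y j = ∑ j ∈ s.image Prod.snd, z j * y j := by
      refine Finset.sum_subset (Finset.filter_subset _ _) fun j hj hjT => ?_
      have : ∀ i ∈ S, c (i, j) = 0 := by simpa [T, hj] using hjT
      simp only [z]
      rw [Finset.sum_eq_zero fun i hi => by simp [this i hi], zero_mul]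
    have h2 : ∑ ij ∈ S ×ˢ s.image Prod.snd, c ij • ((x ij.1 : L) * y ij.2) = 0 := by
      rw [← hsum]
      exact (Finset.sum_subset s.subset_product fun ij _ hij => by simp [hcs ij hij]).symm
    rw [h1, ← h2, Finset.sum_product_right]
    refine Finset.sum_congr rfl fun j _ => ?_
    rw [Finset.sum_mul]
    exact Finset.sum_congr rfl fun i _ => by rw [Algebra.smul_def, mul_assoc]
  have hs₁ : (i₁, j₁) ∈ s := by
    by_contra hs
    exact hc₁ (hcs _ hs)
  have hT : T.Nonempty :=
    ⟨j₁, Finset.mem_filter.mpr ⟨Finset.mem_image_of_mem _ hs₁, i₁,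
      Finset.mem_image_of_mem _ hs₁, hc₁⟩⟩
  obtain ⟨j₀, hj₀, hmax⟩ := Finset.exists_max_image T (fun j => Ow.valuation (z j * y j)) hT
  obtain ⟨k₀, hk₀, hzk₀⟩ := hz j₀ hj₀
  have hne₀ : Ow.valuation (z j₀ * y j₀) ≠ 0 := by
    rw [map_mul, hzk₀]
    simp [hk₀, hy0]
  have hlt : Ow.valuation (∑ j ∈ T.erase j₀, z j * y j) < Ow.valuation (z j₀ * y j₀) := by
    refine Valuation.map_sum_lt _ hne₀ fun j hj => ?_
    obtain ⟨hjj₀, hjT⟩ := Finset.mem_erase.mp hj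
    refine lt_of_le_of_ne (hmax j hjT) fun heq => hjj₀ ?_
    obtain ⟨k, hk, hzk⟩ := hz j hjT
    refine hy j j₀ (k₀ / k) (div_ne_zero hk₀ hk) ?_
    rw [map_mul, map_mul, hzk, hzk₀] at heq
    rw [map_mul, map_div₀, map_div₀, div_mul_eq_mul_div, ← heq, mul_div_cancel_left₀]
    simpa using hk
  rw [← Finset.add_sum_erase T _ hj₀, add_comm, add_eq_zero_iff_eq_neg] at hzT
  rw [hzT, Valuation.map_neg] at hlt
  exact lt_irrefl _ hlt

/-- The fundamental inequality for a single prolongation. -/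
theorem ramificationIndex_mul_inertiaDegree_le [Algebra K L] [FiniteDimensional K L]
    {Ov : ValuationSubring K} {Ow : ValuationSubring L} (h : Ow.comap (algebraMap K L) = Ov) :
    ramificationIndex (algebraMap K L) Ow ≠ 0 ∧
      (letI := (residueFieldMap (algebraMap K L) Ov Ow h).toAlgebra
      FiniteDimensional (IsLocalRing.ResidueField Ov) (IsLocalRing.ResidueField Ow)) ∧
      ramificationIndex (algebraMap K L) Ow * inertiaDegree (algebraMap K L) Ov Ow ≤
        Module.finrank K L := by
  let := (residueFieldMap (algebraMap K L) Ov Ow h).toAlgebra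
  rw [inertiaDegree_eq_finrank h, ramificationIndex_eq_index, Subgroup.index_eq_card]
  let A := (Units.map (algebraMap K L : K →* L)).range ⊔ Ow.unitGroup
  let b := Module.Free.chooseBasis (IsLocalRing.ResidueField Ov) (IsLocalRing.ResidueField Ow)
  let I := Module.Free.ChooseBasisIndex (IsLocalRing.ResidueField Ov) (IsLocalRing.ResidueField Ow)
  obtain ⟨x, hx⟩ : ∃ x : I → Ow, ∀ i, IsLocalRing.residue Ow (x i) = b i :=
    ⟨fun i => (IsLocalRing.residue_surjective (b i)).choose,
      fun i => (IsLocalRing.residue_surjective (b i)).choose_spec⟩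
  let y : Lˣ ⧸ A → L := fun j => (Quotient.out j : Lˣ)
  have hli : LinearIndependent K fun ij : I × (Lˣ ⧸ A) => (x ij.1 : L) * y ij.2 := by
    refine linearIndependent_mul h x (by simpa only [hx] using b.linearIndependent) y
      (fun j => Units.ne_zero _) fun j j' k hk hjj' => ?_
    rw [← QuotientGroup.out_eq' j, ← QuotientGroup.out_eq' j', eq_comm, QuotientGroup.eq]
    refine mem_range_unitsMap_sup_unitGroup.mpr ⟨Units.mk0 k hk, ?_⟩
    rw [Units.val_mul, map_mul]
    erw [hjj']
    simp [y, mul_comm]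
  have hfin : Finite (I × (Lˣ ⧸ A)) := hli.finite
  have hI : Nonempty I := b.index_nonempty
  have : Finite I := Finite.of_surjective _ (Prod.fst_surjective (α := I) (β := Lˣ ⧸ A))
  have : Finite (Lˣ ⧸ A) := Finite.of_surjective _ (Prod.snd_surjective (α := I) (β := Lˣ ⧸ A))
  refine ⟨Nat.card_pos.ne', Module.Finite.of_basis b, ?_⟩
  have hf : Module.finrank (IsLocalRing.ResidueField Ov) (IsLocalRing.ResidueField Ow) =
    Nat.card I := Module.finrank_eq_nat_card_basis b
  have := Fintype.ofFinite (I × (Lˣ ⧸ A))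
  have hle := hli.fintype_card_le_finrank
  rw [← Nat.card_eq_fintype_card, Nat.card_prod] at hle
  rw [mul_comm]
  exact (congrArg (· * Nat.card (Lˣ ⧸ A)) hf).trans_le hle

section StableValuationSubring

variable {N : Type*} [Field N] [Algebra K N]

theorem ValuationSubring.valuation_algEquiv_of_stable [FiniteDimensional K N]
    {W : ValuationSubring N} (hW : ∀ σ : N ≃ₐ[K] N, ∀ x ∈ W, σ x ∈ W) (σ : N ≃ₐ[K] N) (x : N) :
    W.valuation (σ x) = W.valuation x := by
  have hcomap (σ : N ≃ₐ[K] N) : W.comap (σ : N →+* N) = W := by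
    ext y
    refine ⟨fun hy => ?_, hW σ y⟩
    simpa using hW σ⁻¹ _ (ValuationSubring.mem_comap.mp hy)
  have hlt (σ : N ≃ₐ[K] N) (a b : N) (hab : W.valuation a < W.valuation b) :
      W.valuation (σ a) < W.valuation (σ b) :=
    not_le.mp fun h => not_le.mpr hab ((valuation_le_iff_of_comap_eq (hcomap σ) b a).mpr h)
  have hle (σ : N ≃ₐ[K] N) (x : N) : W.valuation (σ x) ≤ W.valuation x := by
    by_contra! h
    have hpow (k : ℕ) : W.valuation x < W.valuation ((σ ^ (k + 1)) x) := by
      induction k with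
      | zero => simpa using h
      | succ k ih =>
        rw [pow_succ', AlgEquiv.mul_apply]
        exact h.trans (hlt σ _ _ ih)
    have := hpow (orderOf σ - 1)
    rw [Nat.sub_add_cancel (orderOf_pos σ), pow_orderOf_eq_one] at this
    exact lt_irrefl _ this
  refine le_antisymm (hle σ x) ?_
  simpa using hle σ⁻¹ (σ x)

/-- The subgroup of automorphisms changing `x` only by a factor in the principal units. -/
def principalStabilizer (W : ValuationSubring N)
    (hW : ∀ (σ : N ≃ₐ[K] N) (x : N), W.valuation (σ x) = W.valuation x) (x : N) (hx : x ≠ 0) :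
    Subgroup (N ≃ₐ[K] N) where
  carrier := {σ | W.valuation (σ x - x) < W.valuation x}
  one_mem' := by simpa [zero_lt_iff] using hx
  mul_mem' {σ τ} hσ hτ := by
    have h : (σ * τ) x - x = σ (τ x - x) + (σ x - x) := by simp
    change W.valuation ((σ * τ) x - x) < _
    rw [h]
    exact Valuation.map_add_lt _ ((hW σ _).trans_lt hτ) hσ
  inv_mem' {σ} hσ := by
    have h : σ⁻¹ x - x = -σ⁻¹ (σ x - x) := by simp
    change W.valuation (σ⁻¹ x - x) < _
    rw [h, Valuation.map_neg, hW]
    exact hσ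

theorem algebraMap_surjective_of_valuation_sub_lt [FiniteDimensional K N] [IsGalois K N]
    [Algebra K L] [Algebra L N] [IsScalarTower K L N] {W : ValuationSubring N}
    (hn : W.valuation (Module.finrank K N : N) = 1)
    (h : ∀ x : L, x ≠ 0 → ∀ σ : N ≃ₐ[K] N,
      W.valuation (σ (algebraMap L N x) - algebraMap L N x) < W.valuation (algebraMap L N x)) :
    Function.Surjective (algebraMap K L) := by
  intro x
  let n := Module.finrank K N
  let t := Algebra.trace K N (algebraMap L N x)
  have hnN : (n : N) ≠ 0 := fun h0 => by simp [n, h0] at hn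
  let y := x - algebraMap K L (t / n)
  have hycast : algebraMap L N y = algebraMap L N x - algebraMap K N (t / n) := by
    simp [y, IsScalarTower.algebraMap_apply K L N]
  have hcard : Fintype.card (N ≃ₐ[K] N) = n :=
    Nat.card_eq_fintype_card.symm.trans (IsGalois.card_aut_eq_finrank K N)
  have hsum : ∑ σ : N ≃ₐ[K] N, σ (algebraMap L N y) = 0 := by
    simp only [hycast, map_sub, AlgEquiv.commutes, Finset.sum_sub_distrib]
    rw [← trace_eq_sum_automorphisms, Finset.sum_const, Finset.card_univ, hcard, map_div₀,
      map_natCast, nsmul_eq_mul, mul_div_cancel₀ _ hnN, sub_self]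
  suffices hy : y = 0 from ⟨t / n, (sub_eq_zero.mp hy).symm⟩
  by_contra hy
  have hy0 : W.valuation (algebraMap L N y) ≠ 0 := by simpa using hy
  have hlt : W.valuation (∑ σ : N ≃ₐ[K] N, (σ (algebraMap L N y) - algebraMap L N y)) <
      W.valuation (algebraMap L N y) :=
    Valuation.map_sum_lt _ hy0 fun σ _ => h y hy σ
  rw [Finset.sum_sub_distrib, hsum, zero_sub, Valuation.map_neg, Finset.sum_const,
    Finset.card_univ, hcard, nsmul_eq_mul, map_mul, hn, one_mul] at hlt
  exact lt_irrefl _ hlt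

theorem exists_algEquiv_eq_algHom [FiniteDimensional K N] [Normal K N] [Algebra K L] [Algebra L N]
    [IsScalarTower K L N] (φ : L →ₐ[K] N) :
    ∃ σ : N ≃ₐ[K] N, ∀ x, φ x = σ (algebraMap L N x) :=
  ⟨AlgEquiv.ofBijective (φ.liftNormal N) (AlgHom.normal_bijective K N N _),
    fun x => (φ.liftNormal_commutes N x).symm⟩

theorem algEquiv_algebraMap_eq_of_mem_principalStabilizer [FiniteDimensional K N] [IsGalois K N]
    [Algebra K L] [Algebra L N] [IsScalarTower K L N] {W : ValuationSubring N}
    (hW : ∀ (σ : N ≃ₐ[K] N) (x : N), W.valuation (σ x) = W.valuation x)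
    (hsimple : ∀ M : IntermediateField K L, M = ⊥ ∨ M = ⊤) {x : L} (hx : algebraMap L N x ≠ 0)
    (hne : principalStabilizer W hW (algebraMap L N x) hx ≠ ⊤) {σ : N ≃ₐ[K] N}
    (hσ : σ ∈ principalStabilizer W hW (algebraMap L N x) hx) (y : L) :
    σ (algebraMap L N y) = algebraMap L N y := by
  let H := principalStabilizer W hW (algebraMap L N x) hx
  let F := IntermediateField.fixedField H
  let ι := IsScalarTower.toAlgHom K L N
  rcases hsimple (F.comap ι) with h | h
  · refine absurd ?_ hne
    have hle : F ≤ ι.fieldRange := by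
      rw [← IsGalois.fixedField_fixingSubgroup ι.fieldRange]
      refine IntermediateField.fixedField_antitone fun τ hτ => ?_
      have hτx : τ (algebraMap L N x) = algebraMap L N x :=
        (IntermediateField.mem_fixingSubgroup_iff _ _).mp hτ _ ⟨x, rfl⟩
      change W.valuation (τ (algebraMap L N x) - algebraMap L N x) < _
      rw [hτx, sub_self, map_zero, zero_lt_iff]
      simpa using hx
    have hF : F = ⊥ := by
      rw [eq_bot_iff]
      intro z hz
      obtain ⟨w, rfl⟩ := hle hz
      have hw : w ∈ F.comap ι := hz
      rw [h] at hw
      obtain ⟨k, rfl⟩ := IntermediateField.mem_bot.mp hw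
      exact IntermediateField.mem_bot.mpr ⟨k, (ι.commutes k).symm⟩
    exact (IntermediateField.fixingSubgroup_fixedField H).symm.trans
      (show F.fixingSubgroup = ⊤ by rw [hF, IntermediateField.fixingSubgroup_bot])
  · have hy : y ∈ F.comap ι := h ▸ IntermediateField.mem_top
    exact (IntermediateField.mem_fixedField_iff H _).mp hy σ hσ

theorem finrank_le_of_forall_intermediateField [FiniteDimensional K N] [IsGalois K N]
    [Algebra K L] [Algebra L N] [IsScalarTower K L N] {W : ValuationSubring N}
    (hW : ∀ (σ : N ≃ₐ[K] N), ∀ x ∈ W, σ x ∈ W)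
    (hn : W.valuation (Module.finrank K N : N) = 1)
    (hsimple : ∀ M : IntermediateField K L, M = ⊥ ∨ M = ⊤) :
    Module.finrank K L ≤ ramificationIndex (algebraMap K L) (W.comap (algebraMap L N)) *
      inertiaDegree (algebraMap K L) (W.comap (algebraMap K N)) (W.comap (algebraMap L N)) := by
  classical
  have hv := ValuationSubring.valuation_algEquiv_of_stable hW
  have : FiniteDimensional K L := FiniteDimensional.left K L N
  have : Algebra.IsSeparable K L := Algebra.isSeparable_tower_bot_of_isSeparable K L N
  have hφcomap (φ : L →ₐ[K] N) : W.comap (φ : L →+* N) = W.comap (algebraMap L N) := by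
    obtain ⟨σ, hσ⟩ := exists_algEquiv_eq_algHom φ
    ext x
    rw [ValuationSubring.mem_comap, ValuationSubring.mem_comap, ← W.valuation_le_one_iff,
      ← W.valuation_le_one_iff, ← hv σ (algebraMap L N x), ← hσ]
    rfl
  generalize hOv : W.comap (algebraMap K N) = Ov
  generalize hOw : W.comap (algebraMap L N) = Ow at hφcomap ⊢
  have hvw : Ow.comap (algebraMap K L) = Ov := by
    rw [← hOv, ← hOw, IsScalarTower.algebraMap_eq K L N]; rfl
  obtain ⟨he, hfin, -⟩ := ramificationIndex_mul_inertiaDegree_le hvw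
  let : Algebra (IsLocalRing.ResidueField Ov) (IsLocalRing.ResidueField Ow) :=
    (residueFieldMap (algebraMap K L) Ov Ow hvw).toAlgebra
  have hf : inertiaDegree (algebraMap K L) Ov Ow =
    Module.finrank (IsLocalRing.ResidueField Ov) (IsLocalRing.ResidueField Ow) :=
      inertiaDegree_eq_finrank hvw
  by_cases hall : ∀ x : L, x ≠ 0 → ∀ σ : N ≃ₐ[K] N,
      W.valuation (σ (algebraMap L N x) - algebraMap L N x) < W.valuation (algebraMap L N x)
  · have hsurj := algebraMap_surjective_of_valuation_sub_lt hn hall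
    have h1 : Module.finrank K L = 1 :=
      finrank_eq_one (1 : L) one_ne_zero fun w => by
        obtain ⟨c, rfl⟩ := hsurj w
        exact ⟨c, by rw [Algebra.smul_def, mul_one]⟩
    rw [h1, hf]
    exact Nat.mul_pos (Nat.pos_of_ne_zero he) Module.finrank_pos
  push Not at hall
  obtain ⟨x, hx0, σ₀, hσ₀⟩ := hall
  have hxN : algebraMap L N x ≠ 0 := by simpa using hx0
  have hfix {σ : N ≃ₐ[K] N} :=
    algEquiv_algebraMap_eq_of_mem_principalStabilizer (σ := σ) hv hsimple hxN
      fun h => not_lt.mpr hσ₀ (show σ₀ ∈ principalStabilizer W hv _ hxN from h ▸ Subgroup.mem_top _)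
  -- a power of `x` is an element of `K` times a unit
  rw [ramificationIndex_eq_index, Subgroup.index_eq_card] at he ⊢
  set A := (Units.map (algebraMap K L : K →* L)).range ⊔ Ow.unitGroup with hA
  have : Finite (Lˣ ⧸ A) := Nat.finite_of_card_ne_zero he
  let q := orderOf (QuotientGroup.mk (Units.mk0 x hx0) : Lˣ ⧸ A)
  have hq : 0 < q :=
    (isOfFinOrder_of_finite (QuotientGroup.mk (Units.mk0 x hx0) : Lˣ ⧸ A)).orderOf_pos
  obtain ⟨k, hk⟩ : ∃ k : Kˣ, Ow.valuation (x ^ q) = Ow.valuation (algebraMap K L k) := by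
    have h : (Units.mk0 x hx0) ^ q ∈ A := by
      rw [← QuotientGroup.eq_one_iff, QuotientGroup.mk_pow, pow_orderOf_eq_one]
    simpa using mem_range_unitsMap_sup_unitGroup.mp h
  have huval : Ow.valuation (x ^ q / algebraMap K L k) = 1 := by
    rw [map_div₀, hk, div_self (by simp)]
  let u : Ow := ⟨x ^ q / algebraMap K L k, (Ow.valuation_le_one_iff _).mp huval.le⟩
  have huunit : IsUnit u := (Ow.valuation_eq_one_iff u).mpr huval
  let ubar := IsLocalRing.residue Ow u
  have hubar : ubar ≠ 0 := (IsLocalRing.residue_ne_zero_iff_isUnit u).mpr huunit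
  let P := ((minpoly (IsLocalRing.ResidueField Ov) ubar).map
    (residueFieldMap (algebraMap K N) Ov W hOv)).comp
      (Polynomial.C (residueFieldMap (algebraMap L N) Ow W hOw ubar) * Polynomial.X ^ q)
  have hint : IsIntegral (IsLocalRing.ResidueField Ov) ubar := Algebra.IsIntegral.isIntegral _
  have hdeg : P.natDegree = (minpoly (IsLocalRing.ResidueField Ov) ubar).natDegree * q := by
    rw [Polynomial.natDegree_comp, Polynomial.natDegree_map,
      Polynomial.natDegree_C_mul_X_pow _ _ (by simpa using hubar)]
  have hP0 : P ≠ 0 := by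
    intro h
    rw [h, Polynomial.natDegree_zero] at hdeg
    exact (Nat.mul_pos (minpoly.natDegree_pos hint) hq).ne hdeg
  have hzmem (φ : L →ₐ[K] N) : φ x / algebraMap L N x ∈ W := by
    obtain ⟨σ, hσ⟩ := exists_algEquiv_eq_algHom φ
    rw [← W.valuation_le_one_iff, hσ, map_div₀, hv, div_self (by simpa using hx0)]
  let ζ : (L →ₐ[K] N) → IsLocalRing.ResidueField W := fun φ =>
    IsLocalRing.residue W ⟨_, hzmem φ⟩
  have hζroot (φ : L →ₐ[K] N) : ζ φ ∈ P.roots.toFinset := by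
    rw [Multiset.mem_toFinset, Polynomial.mem_roots hP0, Polynomial.IsRoot.def,
      Polynomial.eval_comp, Polynomial.eval_map]
    have h1 : Polynomial.eval (ζ φ)
        (Polynomial.C (residueFieldMap (algebraMap L N) Ow W hOw ubar) * Polynomial.X ^ q) =
          residueFieldMap (φ : L →+* N) Ow W (hφcomap φ) ubar := by
      simp only [Polynomial.eval_mul, Polynomial.eval_C, Polynomial.eval_pow, Polynomial.eval_X,
        ubar, residueFieldMap_residue, ζ]
      rw [← map_pow, ← map_mul]
      congr 1
      apply Subtype.ext
      change algebraMap L N (x ^ q / algebraMap K L k) * (φ x / algebraMap L N x) ^ q =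
        φ (x ^ q / algebraMap K L k)
      rw [map_div₀, map_div₀, AlgHom.commutes, ← IsScalarTower.algebraMap_apply, map_pow, map_pow,
        div_pow, div_mul_div_comm, mul_comm (algebraMap L N x ^ q),
        mul_div_mul_right _ _ (pow_ne_zero q hxN)]
    have h3 : (residueFieldMap (φ : L →+* N) Ow W (hφcomap φ)).comp
        (algebraMap (IsLocalRing.ResidueField Ov) (IsLocalRing.ResidueField Ow)) =
          residueFieldMap (algebraMap K N) Ov W hOv := by
      ext c
      obtain ⟨c, rfl⟩ := IsLocalRing.residue_surjective c
      change IsLocalRing.residue W _ = IsLocalRing.residue W _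
      congr 1
      exact Subtype.ext (φ.commutes c)
    rw [h1, ← h3, ← Polynomial.hom_eval₂, ← Polynomial.aeval_def, minpoly.aeval, map_zero]
  have hζinj : Function.Injective ζ := by
    intro φ ψ h
    obtain ⟨σ, hσ⟩ := exists_algEquiv_eq_algHom φ
    obtain ⟨τ, hτ⟩ := exists_algEquiv_eq_algHom ψ
    have h1 := Ideal.Quotient.eq.mp h
    rw [ValuationSubring.valuation_lt_one_iff] at h1
    change W.valuation (φ x / algebraMap L N x - ψ x / algebraMap L N x) < 1 at h1
    rw [← sub_div, map_div₀, div_lt_one₀ (by simpa [zero_lt_iff] using hx0), hσ, hτ,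
      ← hv τ⁻¹, map_sub] at h1
    ext y
    have h2 := hfix (σ := τ⁻¹ * σ)
      (by
        change W.valuation ((τ⁻¹ * σ) (algebraMap L N x) - algebraMap L N x) < _
        simpa using h1) y
    rw [hσ, hτ]
    conv_rhs => rw [← h2]
    simp
  have hcard : Nat.card (L →ₐ[K] N) = Module.finrank K L :=
    AlgHom.natCard_of_splits K L N fun y => by
      rw [← minpoly.algebraMap_eq (algebraMap L N).injective]
      exact Normal.splits inferInstance _
  calc Module.finrank K L = Nat.card (L →ₐ[K] N) := hcard.symm
    _ ≤ Nat.card P.roots.toFinset :=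
      Nat.card_le_card_of_injective (fun φ => (⟨ζ φ, hζroot φ⟩ : P.roots.toFinset))
        fun φ ψ h => hζinj (congrArg Subtype.val h)
    _ ≤ P.natDegree := by
      rw [Nat.card_eq_fintype_card, Fintype.card_coe]
      exact (Multiset.toFinset_card_le _).trans (Polynomial.card_roots' P)
    _ = q * (minpoly (IsLocalRing.ResidueField Ov) ubar).natDegree := by rw [hdeg, mul_comm]
    _ ≤ _ := Nat.mul_le_mul (orderOf_le_card) (hf ▸ minpoly.natDegree_le ubar)

end StableValuationSubring

/-- If a finite Galois extension `N` of `K`, of degree a unit, carries a valuation subring stable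
under the Galois group, then its restrictions to all intermediate fields are defectless. -/
theorem finrank_eq_ramificationIndex_mul_inertiaDegree (n : ℕ) {K L N : Type u} [Field K] [Field L]
    [Field N] [Algebra K N] [Algebra K L] [Algebra L N] [IsScalarTower K L N]
    [FiniteDimensional K N] [IsGalois K N] {W : ValuationSubring N}
    (hW : ∀ (σ : N ≃ₐ[K] N), ∀ x ∈ W, σ x ∈ W)
    (hn : W.valuation (Module.finrank K N : N) = 1) (hKL : Module.finrank K L = n) :
    n = ramificationIndex (algebraMap K L) (W.comap (algebraMap L N)) *
      inertiaDegree (algebraMap K L) (W.comap (algebraMap K N)) (W.comap (algebraMap L N)) := by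
  induction n using Nat.strong_induction_on generalizing K L with
  | _ n ih =>
  have : FiniteDimensional K L := FiniteDimensional.left K L N
  have hcomap (F E : Type u) [Field F] [Field E] [Algebra F E] [Algebra F N] [Algebra E N]
      [IsScalarTower F E N] :
      (W.comap (algebraMap E N)).comap (algebraMap F E) = W.comap (algebraMap F N) := by
    rw [IsScalarTower.algebraMap_eq F E N]; rfl
  by_cases hsimple : ∀ M : IntermediateField K L, M = ⊥ ∨ M = ⊤
  · exact le_antisymm (hKL ▸ finrank_le_of_forall_intermediateField hW hn hsimple)
      (hKL ▸ (ramificationIndex_mul_inertiaDegree_le (hcomap K L)).2.2)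
  push Not at hsimple
  obtain ⟨M, hbot, htop⟩ := hsimple
  have hmul := Module.finrank_mul_finrank K M L
  have h1 : 1 < Module.finrank K M :=
    lt_of_le_of_ne Module.finrank_pos fun h => hbot (IntermediateField.finrank_eq_one_iff.mp h.symm)
  have h2 : 1 < Module.finrank M L :=
    lt_of_le_of_ne Module.finrank_pos fun h =>
      htop (IntermediateField.finrank_eq_one_iff_eq_top.mp h.symm)
  have : IsGalois M N := IsGalois.tower_top_of_isGalois K M N
  have : FiniteDimensional M N := FiniteDimensional.right K M N
  have hnM : W.valuation (Module.finrank M N : N) = 1 := by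
    have hle (m : ℕ) : W.valuation (m : N) ≤ 1 :=
      (W.valuation_le_one_iff _).mpr (natCast_mem W m)
    rw [← Module.finrank_mul_finrank K M N, Nat.cast_mul, map_mul] at hn
    refine le_antisymm (hle _) ?_
    rw [← hn]
    exact mul_le_of_le_one_left' (hle _)
  have hKM := ih (K := K) (L := M) (Module.finrank K M) (by rw [← hKL, ← hmul]; nlinarith)
    hW hn rfl
  have hML := ih (K := M) (L := L) (Module.finrank M L) (by rw [← hKL, ← hmul]; nlinarith)
    (fun σ => hW (σ.restrictScalars K)) hnM rfl
  have hram := ramificationIndex_comp (algebraMap K M) (algebraMap M L) (W.comap (algebraMap L N))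
  have hin := inertiaDegree_comp (hcomap K M) (hcomap M L)
  rw [← IsScalarTower.algebraMap_eq] at hram hin
  rw [hcomap] at hram
  rw [hram, hin, ← hKL, ← hmul, hKM, hML]
  ring

theorem exists_valuationSubring_toSubring_eq_integralClosure {K : Type*} [Field K] (Ov : ValuationSubring K)
    [HenselianLocalRing Ov] (N : Type*) [Field N] [Algebra K N] [FiniteDimensional K N]
    [IsGalois K N] :
    ∃ W : ValuationSubring N, W.toSubring = (integralClosure Ov N).toSubring := by
  let B := integralClosure Ov N
  have : IsFractionRing B N := integralClosure.isFractionRing_of_finite_extension K N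
  have := Algebra.isInvariant_of_isGalois' Ov K N B
  have : Finite (B ≃ₐ[Ov] B) := Finite.of_equiv _ (galRestrict Ov K N B).toEquiv
  exact exists_valuationSubring_toSubring_eq Ov
    (isLocalRing_of_henselian_of_isInvariant Ov B (B ≃ₐ[Ov] B))

theorem fundamentalEquality_of_isGalois {K L N : Type u} [Field K] [Field L] [Field N]
    [Algebra K L] [Algebra K N] [Algebra L N] [IsScalarTower K L N] [FiniteDimensional K N]
    [IsGalois K N] (Ov : ValuationSubring K) [HenselianLocalRing Ov]
    (hn : Ov.valuation (Module.finrank K N : K) = 1) : FundamentalEquality Ov L := by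
  obtain ⟨W, hWB⟩ := exists_valuationSubring_toSubring_eq_integralClosure Ov N
  have hmem {x : N} : x ∈ W ↔ IsIntegral Ov x := by
    rw [← W.mem_toSubring, hWB]; rfl
  have : FiniteDimensional K L := FiniteDimensional.left K L N
  have hKN : W.comap (algebraMap K N) = Ov := by
    ext x
    rw [ValuationSubring.mem_comap, hmem, isIntegral_algebraMap_iff (algebraMap K N).injective,
      IsIntegrallyClosed.isIntegral_iff]
    exact ⟨fun ⟨y, hy⟩ => hy ▸ y.2, fun hx => ⟨⟨x, hx⟩, rfl⟩⟩
  have hKL : (W.comap (algebraMap L N)).comap (algebraMap K L) = Ov := by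
    rw [← hKN, IsScalarTower.algebraMap_eq K L N]; rfl
  have hint {x : L} (hx : x ∈ W.comap (algebraMap L N)) : IsIntegral Ov x := by
    rwa [ValuationSubring.mem_comap, hmem,
      isIntegral_algebraMap_iff (algebraMap L N).injective] at hx
  have hprol : prolongations Ov L = {W.comap (algebraMap L N)} := by
    ext Ow
    refine ⟨fun hOw => ?_, fun h => h ▸ hKL⟩
    refine (ValuationSubring.eq_of_le_of_isIntegral hKL hOw (fun x hx => ?_) fun b => ?_).symm
    · obtain ⟨P, hP, hPx⟩ := hint hx
      have h : IsIntegral Ow x := by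
        refine ⟨P.map (prolongHom _ Ov Ow hOw), hP.map _, ?_⟩
        rw [Polynomial.eval₂_map]
        exact hPx
      obtain ⟨y, rfl⟩ := IsIntegrallyClosed.isIntegral_iff.mp h
      exact y.2
    · obtain ⟨P, hP, hPb⟩ := hint b.2
      refine ⟨P, hP, Subtype.ext ?_⟩
      have h := Polynomial.hom_eval₂ P (prolongHom _ Ov _ hKL)
        (W.comap (algebraMap L N)).subtype b
      exact h.trans hPb
  rw [FundamentalEquality, hprol]
  refine ⟨Set.finite_singleton _, ?_⟩
  rw [finsum_mem_singleton]
  have hnW : W.valuation (Module.finrank K N : N) = 1 := by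
    simpa using (ValuationSubring.valuation_eq_iff_of_comap_eq hKN
      (Module.finrank K N : K) 1).mp (hn.trans (map_one _).symm)
  subst hKN
  exact finrank_eq_ramificationIndex_mul_inertiaDegree _
    (fun σ x hx => hmem.mpr ((hmem.mp hx).map (σ.restrictScalars _))) hnW rfl

/-- Let `(K, O_v)` be a valued field such that `O_v` is a henselian local ring, the
residue field of `O_v` has characteristic `p > 0`, and `K` has no finite separable
extension of degree divisible by `p`.  Then `(K, O_v)` is separably defectless. -/
theorem isSeparablyDefectless_of_henselian_of_no_sep_p_ext
    {K : Type u} [Field K] (Ov : ValuationSubring K)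
    [HenselianLocalRing Ov] (p : ℕ) (hp : p.Prime)
    (hres : CharP (IsLocalRing.ResidueField Ov) p)
    (hsep : ∀ (L : Type u) [Field L] [Algebra K L], FiniteDimensional K L →
      Algebra.IsSeparable K L → ¬ p ∣ Module.finrank K L) :
    IsSeparablyDefectless Ov := by
  intro L _ _ _ _
  have : IsSepClosure K (SeparableClosure L) :=
    ⟨inferInstance, Algebra.IsSeparable.trans K L (SeparableClosure L)⟩
  let N := IntermediateField.normalClosure K L (SeparableClosure L)
  refine fundamentalEquality_of_isGalois (N := N) Ov ?_
  have hN := hsep N inferInstance inferInstance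
  have h : IsUnit (Module.finrank K N : Ov) := by
    rw [← IsLocalRing.residue_ne_zero_iff_isUnit, map_natCast, Ne, CharP.cast_eq_zero_iff _ p]
    exact hN
  simpa using (Ov.valuation_eq_one_iff _).mp h
end

section
/- A valued field (K, O_v) is defectless if and only if for every finite normal field extension L/K the set of prolongations of O_v to L is finite and [L:K] = Σ_w e(w/v)·f(w/v), the sum ranging over all prolongations w of v to L. -/
variable {K : Type*} [Field K] {L : Type*} [Field L]

theorem exists_pos_forall_geom_sum_ne_zero {F : Type*} [Field F] (a : F) :
    ∃ m : ℕ, 0 < m ∧ ∀ k : ℕ, ∑ i ∈ Finset.range (m * k + 1), a ^ i ≠ 0 := by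
  by_cases ha : a = 1
  · subst ha
    by_cases hp : ringChar F = 0
    · have : CharZero F := (CharP.ringChar_zero_iff_CharZero F).mp hp
      refine ⟨1, one_pos, fun k => ?_⟩
      simpa using Nat.cast_add_one_ne_zero (R := F) k
    · refine ⟨ringChar F, Nat.pos_of_ne_zero hp, fun k => ?_⟩
      simp
  · have key : ∀ n : ℕ, a ^ n ≠ 1 → ∑ i ∈ Finset.range n, a ^ i ≠ 0 := by
      intro n hn h0
      have := geom_sum_mul a n
      rw [h0, zero_mul] at this
      exact hn (sub_eq_zero.mp this.symm)
    by_cases ho : orderOf a = 0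
    · refine ⟨1, one_pos, fun k => key _ fun h => ?_⟩
      have := orderOf_dvd_of_pow_eq_one h
      rw [ho] at this
      simp at this
    · refine ⟨orderOf a, Nat.pos_of_ne_zero ho, fun k => key _ ?_⟩
      rwa [pow_add, pow_mul, pow_orderOf_eq_one, one_pow, one_mul, pow_one]

theorem ValuationSubring.exists_pos_forall_valuation_geom_sum_eq_one (O : ValuationSubring L)
    (u : L) :
    ∃ m : ℕ, 0 < m ∧ (u ∈ O → ∀ k : ℕ,
      O.valuation (∑ i ∈ Finset.range (m * k + 1), u ^ i) = 1) := by
  by_cases hu : u ∈ O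
  · obtain ⟨m, hm, h⟩ := exists_pos_forall_geom_sum_ne_zero (IsLocalRing.residue O ⟨u, hu⟩)
    refine ⟨m, hm, fun _ k => ?_⟩
    have hk := h k
    simp_rw [← map_pow, ← map_sum] at hk
    rw [IsLocalRing.residue_ne_zero_iff_isUnit, O.valuation_eq_one_iff] at hk
    simpa using hk
  · exact ⟨1, one_pos, fun h => absurd h hu⟩

theorem ValuationSubring.valuation_geom_sum_of_notMem (O : ValuationSubring L) {u : L}
    (hu : u ∉ O) (n : ℕ) :
    O.valuation (∑ i ∈ Finset.range (n + 1), u ^ i) = O.valuation u ^ n := by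
  have h1 : 1 < O.valuation u := by
    rw [← not_le, O.valuation_le_one_iff]; exact hu
  rw [Finset.sum_range_succ, Valuation.map_add_eq_of_lt_right, map_pow]
  rw [map_pow]
  refine Valuation.map_sum_lt _ (pow_ne_zero _ (zero_lt_one.trans h1).ne') fun i hi => ?_
  rw [map_pow]
  exact pow_lt_pow_right₀ h1 (Finset.mem_range.mp hi)

/-- Every element can be written with a denominator that is integral at finitely many
valuation subrings and a unit wherever the element is integral. -/
theorem ValuationSubring.exists_denominator (S : Finset (ValuationSubring L)) (u : L) :
    ∃ q : L, ∀ O ∈ S, O.valuation q ≤ 1 ∧ O.valuation (q * u) ≤ 1 ∧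
      (u ∈ O → O.valuation q = 1) := by
  choose m hm h using fun O : ValuationSubring L =>
    O.exists_pos_forall_valuation_geom_sum_eq_one u
  have hM : ∏ O ∈ S, m O ≠ 0 := Finset.prod_ne_zero_iff.mpr fun O _ => (hm O).ne'
  refine ⟨(∑ i ∈ Finset.range (∏ O ∈ S, m O + 1), u ^ i)⁻¹, fun O hO => ?_⟩
  by_cases hu : u ∈ O
  · have h1 : O.valuation (∑ i ∈ Finset.range (∏ O ∈ S, m O + 1), u ^ i)⁻¹ = 1 := by
      obtain ⟨k, hk⟩ := Finset.dvd_prod_of_mem m hO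
      rw [map_inv₀, hk, h O hu k, inv_one]
    refine ⟨h1.le, ?_, fun _ => h1⟩
    rw [map_mul, h1, one_mul, O.valuation_le_one_iff]
    exact hu
  · have h1 : 1 < O.valuation u := by
      rw [← not_le, O.valuation_le_one_iff]; exact hu
    rw [map_mul, map_inv₀, O.valuation_geom_sum_of_notMem hu]
    refine ⟨inv_le_one_of_one_le₀ (one_le_pow₀ h1.le), ?_, fun h => absurd h hu⟩
    rw [inv_mul_le_one₀ (pow_pos (zero_lt_one.trans h1) _)]
    exact le_self_pow₀ h1.le hM

/-- For pairwise incomparable valuation subrings, there is an element that is a unit at one of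
them and small at the others, even after multiplication by given integral elements. -/
theorem ValuationSubring.exists_unit_of_incomparable (S : Finset (ValuationSubring L))
    (O : ValuationSubring L) (hO : O ∈ S)
    (hS : ∀ A ∈ S, A ≠ O → ¬ A ≤ O ∧ ¬ O ≤ A) (U : Finset L) (hU : ∀ u ∈ U, u ∈ O) :
    ∃ p : L, O.valuation p = 1 ∧ ∀ A ∈ S, A ≠ O → A.valuation p < 1 ∧
      ∀ u ∈ U, A.valuation (p * u) < 1 := by
  classical
  choose q hq using ValuationSubring.exists_denominator S
  have hsep : ∀ A : ValuationSubring L, ∃ p : L, O.valuation p = 1 ∧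
      (∀ B ∈ S, B.valuation p ≤ 1) ∧ (A ∈ S → A ≠ O → A.valuation p < 1) := by
    intro A
    by_cases hA : A ∈ S ∧ A ≠ O
    · obtain ⟨h1, h2⟩ := hS A hA.1 hA.2
      obtain ⟨s, hsA, hsO⟩ := SetLike.not_le_iff_exists.mp h1
      obtain ⟨t, htO, htA⟩ := SetLike.not_le_iff_exists.mp h2
      rw [← ValuationSubring.valuation_le_one_iff] at hsA htO
      rw [← ValuationSubring.valuation_le_one_iff, not_le] at hsO htA
      have hO1 : t / s ∈ O := by
        rw [← ValuationSubring.valuation_le_one_iff, map_div₀]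
        exact div_le_one_of_le₀ (htO.trans hsO.le) zero_le
      have hs0 : A.valuation s ≠ 0 := by
        rw [Valuation.ne_zero_iff]
        rintro rfl
        simp at hsO
      have hA1 : 1 < A.valuation (t / s) := by
        rw [map_div₀, one_lt_div₀ (zero_lt_iff.mpr hs0)]
        exact hsA.trans_lt htA
      refine ⟨q (t / s), (hq _ O hO).2.2 hO1, fun B hB => (hq _ B hB).1, fun _ _ => ?_⟩
      by_contra! hc
      have := (hq (t / s) A hA.1).2.1
      rw [map_mul] at this
      exact absurd this (not_le.mpr (hA1.trans_le (le_mul_of_one_le_left' hc)))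
    · exact ⟨1, by simp, by simp, fun h1 h2 => absurd ⟨h1, h2⟩ hA⟩
  choose p hp1 hp2 hp3 using hsep
  have hP : ∀ A ∈ S, A ≠ O → A.valuation (∏ B ∈ S, p B) < 1 := by
    intro A hA hne
    rw [← Finset.mul_prod_erase S p hA, map_mul, map_prod]
    exact mul_lt_one_of_lt_of_le (hp3 A hA hne)
      (Finset.prod_le_one' fun B _ => hp2 B A hA)
  have hQ : ∀ A ∈ S, ∀ T : Finset L, A.valuation (∏ u ∈ T, q u) ≤ 1 := by
    intro A hA T
    rw [map_prod]
    exact Finset.prod_le_one' fun u _ => (hq u A hA).1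
  refine ⟨(∏ B ∈ S, p B) * ∏ u ∈ U, q u, ?_, fun A hA hne => ⟨?_, fun u hu => ?_⟩⟩
  · rw [map_mul, map_prod, map_prod, Finset.prod_eq_one fun B _ => hp1 B,
      Finset.prod_eq_one fun u hu => (hq u O hO).2.2 (hU u hu), one_mul]
  · rw [map_mul]
    exact mul_lt_one_of_lt_of_le (hP A hA hne) (hQ A hA U)
  · rw [← Finset.mul_prod_erase U q hu, mul_assoc, map_mul, mul_right_comm, map_mul]
    exact mul_lt_one_of_lt_of_le (hP A hA hne)
      (mul_le_one' (hq u A hA).2.1 (hQ A hA _))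

theorem valuation_algebraMap_le_iff [Algebra K L] {Ov : ValuationSubring K}
    {W : ValuationSubring L} (hW : W.comap (algebraMap K L) = Ov) (a b : K) :
    W.valuation (algebraMap K L a) ≤ W.valuation (algebraMap K L b) ↔
      Ov.valuation a ≤ Ov.valuation b := by
  subst hW
  rcases eq_or_ne b 0 with rfl | hb
  · simp
  · have h1 : 0 < W.valuation (algebraMap K L b) := by
      rw [zero_lt_iff, Valuation.ne_zero_iff]; simpa
    have h2 : 0 < (W.comap (algebraMap K L)).valuation b := by
      rw [zero_lt_iff, Valuation.ne_zero_iff]; simpa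
    rw [← div_le_one₀ h1, ← div_le_one₀ h2, ← map_div₀, ← map_div₀, ← map_div₀,
      ValuationSubring.valuation_le_one_iff, ValuationSubring.valuation_le_one_iff,
      ValuationSubring.mem_comap]

theorem valuation_algebraMap_le_one_iff [Algebra K L] {Ov : ValuationSubring K}
    {W : ValuationSubring L} (hW : W.comap (algebraMap K L) = Ov) (a : K) :
    W.valuation (algebraMap K L a) ≤ 1 ↔ a ∈ Ov := by
  subst hW
  rw [ValuationSubring.valuation_le_one_iff, ValuationSubring.mem_comap]

theorem linearIndependent_of_prolongations [Algebra K L] (Ov : ValuationSubring K)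
    {ι : Type*} [Fintype ι] {J M : ι → Type*} [∀ i, Fintype (J i)] [∀ i, Fintype (M i)]
    (W : ι → ValuationSubring L) (hW : ∀ i, (W i).comap (algebraMap K L) = Ov)
    {N : ℕ} (hN : N ≠ 0) (d : ∀ i, J i → K) (t : ∀ i, J i → L) (y : ∀ i, M i → L)
    (hd : ∀ i j, d i j ≠ 0)
    (ht : ∀ i j, (W i).valuation (t i j ^ N) = (W i).valuation (algebraMap K L (d i j)))
    (hy : ∀ i k, (W i).valuation (y i k) ≤ 1)
    (hcoset : ∀ i j j' (c : K),
      (W i).valuation (t i j) = (W i).valuation (algebraMap K L c * t i j') → j = j')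
    (hind : ∀ i (a : M i → K), (∀ k, a k ∈ Ov) →
      (W i).valuation (∑ k, algebraMap K L (a k) * y i k) < 1 → ∀ k, Ov.valuation (a k) < 1)
    (hsmall : ∀ i j k l, l ≠ i →
      (W l).valuation ((t i j * y i k) ^ N) < (W l).valuation (algebraMap K L (d i j))) :
    LinearIndependent K (fun s : Σ i, J i × M i => t s.1 s.2.1 * y s.1 s.2.2) := by
  classical
  rw [Fintype.linearIndependent_iff]
  intro c hc
  by_contra! hne
  obtain ⟨s₁, hs₁⟩ := hne
  obtain ⟨⟨i, j, k⟩, hs, hmax⟩ := (Finset.univ.filter fun s => c s ≠ 0).exists_max_image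
    (fun s => Ov.valuation (c s ^ N * d s.1 s.2.1)) ⟨s₁, by simpa using hs₁⟩
  replace hs : c ⟨i, j, k⟩ ≠ 0 := by simpa using hs
  have hmax' : ∀ s, (W i).valuation (algebraMap K L (c s ^ N * d s.1 s.2.1)) ≤
      (W i).valuation (algebraMap K L (c ⟨i, j, k⟩ ^ N * d i j)) := by
    intro s
    rw [valuation_algebraMap_le_iff (hW i)]
    by_cases h0 : c s = 0
    · simp [h0, hN]
    · exact hmax s (by simpa using h0)
  set w := (W i).valuation with hw
  set c₀ := c ⟨i, j, k⟩ with hc₀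
  set T := algebraMap K L c₀ * t i j with hT
  have hTN : w T ^ N = w (algebraMap K L (c₀ ^ N * d i j)) := by
    rw [hT, ← map_pow, mul_pow, map_mul, ht, map_mul, map_pow, map_mul, map_pow, map_pow]
  have hT0 : w T ≠ 0 := by
    intro h
    rw [h, zero_pow hN, eq_comm, Valuation.zero_iff] at hTN
    simp [hs, hd, hN] at hTN
  have hlt : ∀ s : Σ i, J i × M i, ¬ (∃ k', s = ⟨i, j, k'⟩) →
      w (algebraMap K L (c s) * (t s.1 s.2.1 * y s.1 s.2.2)) < w T := by
    rintro ⟨i', j', k'⟩ hne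
    by_cases h0 : c ⟨i', j', k'⟩ = 0
    · rw [h0, map_zero, zero_mul, map_zero]
      exact zero_lt_iff.mpr hT0
    by_cases hi : i' = i
    · subst hi
      have hle : w (algebraMap K L (c ⟨i', j', k'⟩) * t i' j') ≤ w T := by
        refine le_of_pow_le_pow_left₀ hN zero_le ?_
        rw [hTN, ← map_pow, mul_pow, map_mul, ht, ← map_pow, ← map_mul, ← map_mul]
        exact hmax' ⟨i', j', k'⟩
      have hj : w (algebraMap K L (c ⟨i', j', k'⟩) * t i' j') ≠ w T := by
        intro h
        refine hne ⟨k', ?_⟩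
        rw [hcoset i' j' j ((c ⟨i', j', k'⟩)⁻¹ * c₀)]
        have h0' : algebraMap K L (c ⟨i', j', k'⟩) ≠ 0 := by simpa using h0
        rw [map_mul (algebraMap K L), mul_assoc, ← hT, map_mul, ← hw, ← h, ← map_mul, map_inv₀,
          inv_mul_cancel_left₀ h0']
      rw [← mul_assoc, map_mul]
      exact (mul_le_of_le_one_right' (hy _ _)).trans_lt (lt_of_le_of_ne hle hj)
    · refine lt_of_pow_lt_pow_left₀ N zero_le ?_
      rw [hTN]
      refine lt_of_lt_of_le ?_ (hmax' ⟨i', j', k'⟩)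
      rw [← map_pow, mul_pow, map_mul, map_mul, map_mul, ← map_pow]
      refine mul_lt_mul_of_pos_left (hsmall i' j' k' i (Ne.symm hi)) ?_
      rw [zero_lt_iff, Valuation.ne_zero_iff]
      simp [h0]
  have hcO : ∀ k', c ⟨i, j, k'⟩ / c₀ ∈ Ov := by
    intro k'
    have h := hmax' ⟨i, j, k'⟩
    have hd0 : 0 < w (algebraMap K L (d i j)) := by
      rw [zero_lt_iff, Valuation.ne_zero_iff]; simpa using hd i j
    have hc0 : 0 < w (algebraMap K L c₀) := by
      rw [zero_lt_iff, Valuation.ne_zero_iff]; simpa using hs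
    simp only [map_mul, map_pow] at h
    rw [← valuation_algebraMap_le_one_iff (hW i), map_div₀, map_div₀, div_le_one₀ hc0]
    exact le_of_pow_le_pow_left₀ hN zero_le (le_of_mul_le_mul_right h hd0)
  have hsum : w (∑ k', algebraMap K L (c ⟨i, j, k'⟩ / c₀) * y i k') < 1 := by
    have hTne : T ≠ 0 := by rwa [← Valuation.ne_zero_iff w]
    have hsplit : T * ∑ k', algebraMap K L (c ⟨i, j, k'⟩ / c₀) * y i k' =
        - ∑ s with ¬ ∃ k', s = (⟨i, j, k'⟩ : Σ i, J i × M i),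
          algebraMap K L (c s) * (t s.1 s.2.1 * y s.1 s.2.2) := by
      rw [eq_neg_iff_add_eq_zero, ← hc]
      simp_rw [Algebra.smul_def]
      rw [← Finset.sum_filter_add_sum_filter_not Finset.univ
        (fun s => ∃ k', s = (⟨i, j, k'⟩ : Σ i, J i × M i))]
      congr 1
      rw [Finset.mul_sum]
      refine Finset.sum_bij (fun k' _ => ⟨i, j, k'⟩) (by simp) ?_ ?_ ?_
      · intro a _ b _ hab
        simpa using hab
      · rintro s hs
        obtain ⟨k', rfl⟩ := (Finset.mem_filter.mp hs).2
        exact ⟨k', Finset.mem_univ _, rfl⟩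
      · intro k' _
        have : algebraMap K L c₀ ≠ 0 := by simpa using hs
        rw [hT, map_div₀]
        field_simp
    have h := congrArg w hsplit
    rw [Valuation.map_neg, map_mul] at h
    have hlt' := Valuation.map_sum_lt w hT0
      (fun s (hs : s ∈ Finset.univ.filter
        fun s => ¬ ∃ k', s = (⟨i, j, k'⟩ : Σ i, J i × M i)) => hlt s (Finset.mem_filter.mp hs).2)
    rw [← h] at hlt'
    exact (mul_lt_iff_lt_one_right (zero_lt_iff.mpr hT0)).mp hlt'
  have := hind i _ hcO hsum k
  rw [← hc₀, div_self hs, map_one] at this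
  exact lt_irrefl _ this

theorem mk_unitGroup_eq_iff (W : ValuationSubring L) (a b : Lˣ) :
    (QuotientGroup.mk a : Lˣ ⧸ W.unitGroup) = QuotientGroup.mk b ↔
      W.valuation a = W.valuation b := by
  rw [QuotientGroup.eq, ValuationSubring.mem_unitGroup_iff, Units.val_mul, map_mul,
    Units.val_inv_eq_inv_val, map_inv₀,
    inv_mul_eq_one₀ ((Valuation.ne_zero_iff _).mpr a.ne_zero)]

theorem exists_valuation_pow_ramificationIndex_eq [Algebra K L] (W : ValuationSubring L) {x : L}
    (hx : x ≠ 0) :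
    ∃ c : K, c ≠ 0 ∧ W.valuation (x ^ ramificationIndex (algebraMap K L) W) =
      W.valuation (algebraMap K L c) := by
  have : IsMulCommutative (Lˣ ⧸ W.unitGroup) := ⟨⟨fun a b => mul_comm a b⟩⟩
  obtain ⟨c, hc⟩ := Subgroup.pow_index_mem ((QuotientGroup.mk' W.unitGroup).comp
    (Units.map (algebraMap K L : K →* L))).range (QuotientGroup.mk' W.unitGroup (Units.mk0 x hx))
  refine ⟨c, c.ne_zero, ?_⟩
  rw [← map_pow] at hc
  simpa [ramificationIndex] using ((mk_unitGroup_eq_iff W _ _).mp hc).symm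

theorem exists_valuation_representatives [Algebra K L] (W : ValuationSubring L)
    (he : ramificationIndex (algebraMap K L) W ≠ 0) :
    ∃ x : Fin (ramificationIndex (algebraMap K L) W) → L, (∀ j, x j ≠ 0) ∧
      ∀ j j' (c : K), W.valuation (x j) = W.valuation (algebraMap K L c * x j') → j = j' := by
  set H := ((QuotientGroup.mk' W.unitGroup).comp (Units.map (algebraMap K L : K →* L))).range
  have : Finite ((Lˣ ⧸ W.unitGroup) ⧸ H) := Nat.finite_of_card_ne_zero he
  let e : Fin (ramificationIndex (algebraMap K L) W) ≃ (Lˣ ⧸ W.unitGroup) ⧸ H :=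
    (Finite.equivFinOfCardEq rfl).symm
  choose x hx using fun j => (QuotientGroup.mk_surjective (e j))
  choose z hz using fun j => (QuotientGroup.mk_surjective (x j))
  refine ⟨fun j => z j, fun j => (z j).ne_zero, fun j j' c h => ?_⟩
  have hc : c ≠ 0 := by
    rintro rfl
    simp at h
  apply e.injective
  rw [← hx, ← hx, eq_comm, QuotientGroup.eq]
  refine ⟨Units.mk0 c hc, ?_⟩
  rw [← hz, ← hz, eq_inv_mul_iff_mul_eq]
  refine (mk_unitGroup_eq_iff W _ _).mpr ?_
  rw [h, mul_comm]
  simp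

theorem exists_residue_representatives [Algebra K L] {Ov : ValuationSubring K}
    {W : ValuationSubring L} (hW : W.comap (algebraMap K L) = Ov) :
    ∃ y : Fin (inertiaDegree (algebraMap K L) Ov W) → L, (∀ k, W.valuation (y k) ≤ 1) ∧
      ∀ a : Fin (inertiaDegree (algebraMap K L) Ov W) → K, (∀ k, a k ∈ Ov) →
        W.valuation (∑ k, algebraMap K L (a k) * y k) < 1 → ∀ k, Ov.valuation (a k) < 1 := by
  let := (residueFieldMap (algebraMap K L) Ov W hW).toAlgebra
  have hf : inertiaDegree (algebraMap K L) Ov W =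
      Module.finrank (IsLocalRing.ResidueField Ov) (IsLocalRing.ResidueField W) :=
    dif_pos hW
  rw [hf]
  obtain ⟨b, hb⟩ := exists_linearIndependent_of_le_finrank
    (le_refl (Module.finrank (IsLocalRing.ResidueField Ov) (IsLocalRing.ResidueField W)))
  choose y hy using fun k => IsLocalRing.residue_surjective (b k)
  refine ⟨fun k => y k, fun k => W.valuation_le_one _, fun a ha hsum k => ?_⟩
  have key : ∑ k, IsLocalRing.residue Ov ⟨a k, ha k⟩ • b k = 0 := by
    have h0 : IsLocalRing.residue W
        (∑ k, prolongHom (algebraMap K L) Ov W hW ⟨a k, ha k⟩ * y k) = 0 := by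
      rw [IsLocalRing.residue_eq_zero_iff, ValuationSubring.valuation_lt_one_iff]
      simpa [prolongHom] using hsum
    rw [map_sum] at h0
    rw [← h0]
    refine Finset.sum_congr rfl fun k _ => ?_
    rw [map_mul, hy, Algebra.smul_def]
    rfl
  have := Fintype.linearIndependent_iff.mp hb _ key k
  rwa [IsLocalRing.residue_eq_zero_iff, ValuationSubring.valuation_lt_one_iff] at this

theorem eq_of_le_of_mem_prolongations [Algebra K L] {Ov : ValuationSubring K}
    {A B : ValuationSubring L} (hA : A ∈ prolongations Ov L) (hB : B ∈ prolongations Ov L)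
    (he : ramificationIndex (algebraMap K L) A ≠ 0) (h : A ≤ B) : A = B := by
  refine le_antisymm h fun x hx => ?_
  by_cases hx0 : x = 0
  · rw [hx0]; exact A.zero_mem
  obtain ⟨c, hc0, hc⟩ := exists_valuation_pow_ramificationIndex_eq (K := K) A hx0
  have hcB : c ∈ Ov := by
    rw [← valuation_algebraMap_le_one_iff hB, ← A.mapOfLE_valuation_apply B h, ← hc,
      A.mapOfLE_valuation_apply B h, map_pow]
    exact pow_le_one₀ zero_le ((B.valuation_le_one_iff x).mpr hx)
  rw [← valuation_algebraMap_le_one_iff hA, ← hc, map_pow, pow_le_one_iff_of_nonneg zero_le he,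
    A.valuation_le_one_iff] at hcB
  exact hcB

theorem sum_ramificationIndex_mul_inertiaDegree_le [Algebra K L] [FiniteDimensional K L]
    (Ov : ValuationSubring K) (S : Finset (ValuationSubring L))
    (hS : ∀ W ∈ S, W ∈ prolongations Ov L) :
    ∑ W ∈ S, ramificationIndex (algebraMap K L) W * inertiaDegree (algebraMap K L) Ov W ≤
      Module.finrank K L := by
  classical
  wlog he : ∀ W ∈ S, ramificationIndex (algebraMap K L) W ≠ 0 generalizing S
  · have := this (S.filter fun W => ramificationIndex (algebraMap K L) W ≠ 0)
      (fun W hW => hS W (Finset.mem_filter.mp hW).1) (fun W hW => (Finset.mem_filter.mp hW).2)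
    rwa [Finset.sum_filter_of_ne] at this
    exact fun W _ h => left_ne_zero_of_mul h
  choose x hx0 hxc using fun W : S => exists_valuation_representatives (K := K) W.1 (he W W.2)
  choose y hy hyi using fun W : S => exists_residue_representatives (hS W W.2)
  choose c hc0 hc using fun (W : S) j =>
    exists_valuation_pow_ramificationIndex_eq (K := K) W.1 (hx0 W j)
  set N := ∏ W : S, ramificationIndex (algebraMap K L) W.1 with hN
  have hN0 : N ≠ 0 := Finset.prod_ne_zero_iff.mpr fun W _ => he W W.2
  have hdvd : ∀ W : S, ∃ m, N = ramificationIndex (algebraMap K L) W.1 * m := fun W =>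
    Finset.dvd_prod_of_mem (fun W : S => ramificationIndex (algebraMap K L) W.1)
      (Finset.mem_univ W)
  choose m hm using hdvd
  have hxN : ∀ (W : S) j, W.1.valuation (x W j ^ N) =
      W.1.valuation (algebraMap K L (c W j ^ m W)) := by
    intro W j
    rw [hm W, pow_mul, map_pow, hc, map_pow, map_pow]
  have hp : ∀ (W : S) j, ∃ p : L, W.1.valuation p = 1 ∧ ∀ A ∈ S, A ≠ W.1 →
      A.valuation p < 1 ∧ ∀ u ∈ Finset.univ.image
        (fun k => (x W j * y W k) ^ N / algebraMap K L (c W j ^ m W)),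
        A.valuation (p * u) < 1 := by
    intro W j
    refine ValuationSubring.exists_unit_of_incomparable S W W.2 (fun A hA hne => ⟨?_, ?_⟩) _ ?_
    · exact fun h => hne (eq_of_le_of_mem_prolongations (hS A hA) (hS W W.2) (he A hA) h)
    · exact fun h => hne (eq_of_le_of_mem_prolongations (hS W W.2) (hS A hA) (he W W.2) h).symm
    · intro u hu
      obtain ⟨k, -, rfl⟩ := Finset.mem_image.mp hu
      rw [← ValuationSubring.valuation_le_one_iff, map_div₀, mul_pow, map_mul, hxN,
        mul_div_right_comm, div_self, one_mul, map_pow]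
      · exact pow_le_one₀ zero_le (hy W k)
      · rw [Valuation.ne_zero_iff]
        simpa using fun h => absurd h (hc0 W j)
  choose p hp1 hp2 using hp
  have hli := linearIndependent_of_prolongations Ov (fun W : S => W.1) (fun W => hS W W.2) hN0
    (fun W j => c W j ^ m W) (fun W j => p W j * x W j) y
    (fun W j => pow_ne_zero _ (hc0 W j))
    (fun W j => by rw [mul_pow, map_mul, hxN, map_pow, hp1, one_pow, one_mul]) hy
    (fun W j j' a h => hxc W j j' a (by simpa [hp1] using h)) hyi ?_
  · have := hli.fintype_card_le_finrank
    rw [Fintype.card_sigma] at this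
    simp only [Fintype.card_prod, Fintype.card_fin] at this
    rwa [← Finset.sum_coe_sort]
  · intro W j k A hne
    obtain ⟨h1, h2⟩ := hp2 W j A A.2 (fun h => hne (Subtype.ext h))
    replace h2 := h2 _ (Finset.mem_image_of_mem _ (Finset.mem_univ k))
    have hpos : 0 < A.1.valuation (algebraMap K L (c W j ^ m W)) := by
      rw [zero_lt_iff, Valuation.ne_zero_iff]
      simpa using fun h => absurd h (hc0 W j)
    rw [← div_lt_one₀ hpos, ← map_div₀, mul_assoc, mul_pow, mul_div_assoc,
      ← mul_pow_sub_one hN0, mul_right_comm, map_mul]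
    refine mul_lt_one_of_lt_of_le h2 ?_
    rw [map_pow]
    exact pow_le_one₀ zero_le h1.le

theorem mem_unitGroup_comap_iff {N : Type*} [Field N] (g : L →+* N) (U : ValuationSubring N)
    (x : Lˣ) : x ∈ (U.comap g).unitGroup ↔ Units.map (g : L →* N) x ∈ U.unitGroup := by
  let := g.toAlgebra
  have h := fun a b => valuation_algebraMap_le_iff (rfl : U.comap (algebraMap L N) = _) a b
  have h1 := h x 1
  have h2 := h 1 x
  simp only [map_one] at h1 h2
  rw [ValuationSubring.mem_unitGroup_iff, ValuationSubring.mem_unitGroup_iff]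
  exact ⟨fun hx => le_antisymm (h1.mpr hx.le) (h2.mpr hx.ge),
    fun hx => le_antisymm (h1.mp hx.le) (h2.mp hx.ge)⟩

theorem ramificationIndex_mul {N : Type*} [Field N] (f : K →+* L) (g : L →+* N)
    (U : ValuationSubring N) :
    ramificationIndex (g.comp f) U = ramificationIndex f (U.comap g) * ramificationIndex g U := by
  let φ : Lˣ ⧸ (U.comap g).unitGroup →* Nˣ ⧸ U.unitGroup :=
    QuotientGroup.map _ _ (Units.map (g : L →* N)) fun x hx => by
      exact (mem_unitGroup_comap_iff g U x).mp hx
  have hφ : Function.Injective φ := by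
    rw [injective_iff_map_eq_one]
    intro q hq
    obtain ⟨x, rfl⟩ := QuotientGroup.mk_surjective q
    rw [QuotientGroup.eq_one_iff, mem_unitGroup_comap_iff]
    exact (QuotientGroup.eq_one_iff _).mp hq
  have hr : φ.range = ((QuotientGroup.mk' U.unitGroup).comp (Units.map (g : L →* N))).range := by
    have h1 : φ.comp (QuotientGroup.mk' (U.comap g).unitGroup) =
        (QuotientGroup.mk' U.unitGroup).comp (Units.map (g : L →* N)) := rfl
    rw [← h1, MonoidHom.range_comp, MonoidHom.range_eq_top.mpr (QuotientGroup.mk'_surjective _),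
      ← MonoidHom.range_eq_map]
  unfold ramificationIndex
  rw [← hr, ← Subgroup.index_map_of_injective _ hφ]
  congr 1
  rw [MonoidHom.map_range]
  rfl

theorem inertiaDegree_mul {N : Type*} [Field N] (f : K →+* L) (g : L →+* N)
    {Ov : ValuationSubring K} {W : ValuationSubring L} {U : ValuationSubring N}
    (hW : W.comap f = Ov) (hU : U.comap g = W) :
    inertiaDegree (g.comp f) Ov U = inertiaDegree f Ov W * inertiaDegree g W U := by
  have hVU : U.comap (g.comp f) = Ov := by rw [← hW, ← hU]; rfl
  simp only [inertiaDegree, dif_pos hW, dif_pos hU, dif_pos hVU]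
  let := (residueFieldMap f Ov W hW).toAlgebra
  let := (residueFieldMap g W U hU).toAlgebra
  let := (residueFieldMap (g.comp f) Ov U hVU).toAlgebra
  have : IsScalarTower (IsLocalRing.ResidueField Ov) (IsLocalRing.ResidueField W)
      (IsLocalRing.ResidueField U) := by
    refine IsScalarTower.of_algebraMap_eq fun x => ?_
    obtain ⟨x, rfl⟩ := IsLocalRing.residue_surjective x
    rfl
  exact (Module.finrank_mul_finrank (IsLocalRing.ResidueField Ov) (IsLocalRing.ResidueField W)
      (IsLocalRing.ResidueField U)).symm

theorem ValuationSubring.exists_comap_eq (f : K →+* L) (O : ValuationSubring K) :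
    ∃ W : ValuationSubring L, W.comap f = O := by
  obtain ⟨W, h, hloc⟩ := IsLocalRing.exists_factor_valuationRing (f.comp O.subtype)
  refine ⟨W, le_antisymm (fun x hx => ?_) fun x hx => h ⟨x, hx⟩⟩
  rcases O.mem_or_inv_mem x with hO | hO
  · exact hO
  by_cases hx0 : x = 0
  · rw [hx0]; exact O.zero_mem
  have hu : IsUnit ((f.comp O.subtype).codRestrict W.toSubring h ⟨x⁻¹, hO⟩) := by
    refine IsUnit.of_mul_eq_one ⟨f x, hx⟩ (Subtype.ext ?_)
    change f x⁻¹ * f x = 1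
    rw [← map_mul, inv_mul_cancel₀ hx0, map_one]
  have hu' := hloc.map_nonunit _ hu
  rw [O.valuation_eq_one_iff, map_inv₀, inv_eq_one] at hu'
  exact (O.valuation_le_one_iff x).mp hu'.le

theorem FundamentalEquality.of_tower {N : Type*} [Field N] [Algebra K L] [Algebra K N]
    [Algebra L N] [IsScalarTower K L N] [FiniteDimensional K N] {Ov : ValuationSubring K}
    (h : FundamentalEquality Ov N) : FundamentalEquality Ov L := by
  classical
  obtain ⟨hfin, hsum⟩ := h
  have : FiniteDimensional K L := FiniteDimensional.left K L N
  have : FiniteDimensional L N := FiniteDimensional.right K L N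
  have hcomp : algebraMap K N = (algebraMap L N).comp (algebraMap K L) :=
    IsScalarTower.algebraMap_eq K L N
  have hmaps : ∀ U ∈ prolongations Ov N, U.comap (algebraMap L N) ∈ prolongations Ov L := by
    intro U hU
    rw [prolongations, Set.mem_ofPred_eq, hcomp] at hU
    exact hU
  have hfinL : (prolongations Ov L).Finite := by
    refine (hfin.image fun U => U.comap (algebraMap L N)).subset fun W hW => ?_
    obtain ⟨U, rfl⟩ := ValuationSubring.exists_comap_eq (algebraMap L N) W
    refine ⟨U, ?_, rfl⟩
    rw [prolongations, Set.mem_ofPred_eq, hcomp]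
    exact hW
  refine ⟨hfinL, le_antisymm ?_ ?_⟩
  · refine le_of_mul_le_mul_right ?_ (Module.finrank_pos (R := L) (M := N))
    rw [Module.finrank_mul_finrank, hsum, finsum_mem_eq_finite_toFinset_sum _ hfin,
      finsum_mem_eq_finite_toFinset_sum _ hfinL, Finset.sum_mul,
      ← Finset.sum_fiberwise_of_maps_to (g := fun U => U.comap (algebraMap L N))
        (t := hfinL.toFinset) (by simpa using hmaps)]
    refine Finset.sum_le_sum fun W hW => ?_
    rw [Set.Finite.mem_toFinset] at hW
    refine le_trans (le_of_eq ?_) (Nat.mul_le_mul_left _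
      (sum_ramificationIndex_mul_inertiaDegree_le W
        (hfin.toFinset.filter fun U => U.comap (algebraMap L N) = W)
        fun U hU => (Finset.mem_filter.mp hU).2))
    rw [Finset.mul_sum]
    refine Finset.sum_congr rfl fun U hU => ?_
    have hUW := (Finset.mem_filter.mp hU).2
    rw [hcomp, ramificationIndex_mul, inertiaDegree_mul _ _ hW hUW, hUW]
    ring
  · rw [finsum_mem_eq_finite_toFinset_sum _ hfinL]
    exact sum_ramificationIndex_mul_inertiaDegree_le Ov _ fun W hW => by simpa using hW

/-- A valued field `(K, O_v)` is defectless if and only if the fundamental equality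
holds (with finitely many prolongations) for every finite normal extension `L/K`. -/
theorem isDefectless_iff_fundamentalEquality_of_normal
    {K : Type u} [Field K] (Ov : ValuationSubring K) :
    IsDefectless Ov ↔
      ∀ (L : Type u) [Field L] [Algebra K L], FiniteDimensional K L → Normal K L →
        FundamentalEquality Ov L := by
  refine ⟨fun h L _ _ hL _ => h L hL, fun h L _ _ hL => ?_⟩
  exact (h (IntermediateField.normalClosure K L (AlgebraicClosure L)) inferInstance
    inferInstance).of_tower
end
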